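/- arXiv:2503.23651 — 2 statements merged into one kernel-verified Lean document; each statement's English description precedes it below -/
import Mathlib

section
/- For each m and each 0 ≤ i < j ≤ m, the simplicial maps α_i and α_j from the interval I_{m+1} to I_m are contiguity equivalent. -/
structure ASC (V : Type) where
  faces : Set (Finset V)
  down_closed : ∀ ⦃s t : Finset V⦄, s ∈ faces → t ⊆ s → t ∈ faces

variable {U V W : Type}

/-- A vertex map is a simplicial map if it sends every simplex to a simplex. -/
def IsSimplicialMap [DecidableEq W] (K : ASC V) (L : ASC W) (f : V → W) : Prop :=
  ∀ s ∈ K.faces, s.image f ∈ L.faces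

/-- Two maps are contiguous if `f(σ) ∪ g(σ)` is a simplex for every simplex `σ`. -/
def Contiguous [DecidableEq W] (K : ASC V) (L : ASC W) (f g : V → W) : Prop :=
  ∀ s ∈ K.faces, s.image f ∪ s.image g ∈ L.faces

/-- Contiguity equivalence: a finite chain of contiguities through simplicial maps. -/
def ContigEquiv [DecidableEq W] (K : ASC V) (L : ASC W) : (V → W) → (V → W) → Prop :=
  Relation.ReflTransGen (fun a b =>
    IsSimplicialMap K L a ∧ IsSimplicialMap K L b ∧ Contiguous K L a b)

/-- The categorical product of simplicial complexes. -/
def ASC.prod [DecidableEq V] [DecidableEq W] (K : ASC V) (L : ASC W) : ASC (V × W) where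
  faces := {s | s.image Prod.fst ∈ K.faces ∧ s.image Prod.snd ∈ L.faces}
  down_closed := fun _s _t hs hts =>
    ⟨K.down_closed hs.1 (Finset.image_subset_image hts),
     L.down_closed hs.2 (Finset.image_subset_image hts)⟩

/-- The simplicial interval `I_m` on vertices `0, …, m`. -/
def interval (m : ℕ) : ASC ℕ where
  faces := {s | (∀ x ∈ s, x ≤ m) ∧ ∀ x ∈ s, ∀ y ∈ s, x ≤ y + 1}
  down_closed := fun _s _t hs hts =>
    ⟨fun x hx => hs.1 x (hts hx), fun x hx y hy => hs.2 x (hts hx) y (hts hy)⟩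

/-- The vertex map of `α_i : I_{m+1} → I_m`. -/
def alpha (i : ℕ) : ℕ → ℕ := fun s => if s ≤ i then s else s - 1

/-- The categorical product `I_m × I_n`. -/
def prodInterval (m n : ℕ) : ASC (ℕ × ℕ) := (interval m).prod (interval n)

/-- A face sphere: a simplicial map `(I_m × I_n, ∂(I_m × I_n)) → (X, x₀)`. -/
def IsFaceSphere [DecidableEq V] (X : ASC V) (x₀ : V) (m n : ℕ) (f : ℕ × ℕ → V) : Prop :=
  IsSimplicialMap (prodInterval m n) X f ∧
  ∀ p : ℕ × ℕ, p.1 ≤ m → p.2 ≤ n →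
    (p.1 = 0 ∨ p.1 = m ∨ p.2 = 0 ∨ p.2 = n) → f p = x₀

/-- Contiguity equivalence of face spheres, relative the boundary. -/
def FaceContigEquiv [DecidableEq V] (X : ASC V) (x₀ : V) (m n : ℕ) :
    (ℕ × ℕ → V) → (ℕ × ℕ → V) → Prop :=
  Relation.ReflTransGen (fun a b =>
    IsFaceSphere X x₀ m n a ∧ IsFaceSphere X x₀ m n b ∧
      Contiguous (prodInterval m n) X a b)

/-- The trivial extension `f ∘ (α_m^r × α_n^s)`. -/
def trivExt (m n r s : ℕ) (f : ℕ × ℕ → V) : ℕ × ℕ → V :=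
  f ∘ Prod.map ((alpha m)^[r]) ((alpha n)^[s])

/-- Extension-contiguity equivalence of face spheres of possibly different sizes. -/
def ExtContigEquiv [DecidableEq V] (X : ASC V) (x₀ : V) (m n : ℕ) (f : ℕ × ℕ → V)
    (m' n' : ℕ) (g : ℕ × ℕ → V) : Prop :=
  ∃ M N, m ≤ M ∧ m' ≤ M ∧ n ≤ N ∧ n' ≤ N ∧
    FaceContigEquiv X x₀ M N (trivExt m n (M - m) (N - n) f)
      (trivExt m' n' (M - m') (N - n') g)

/-- The product `f · g` of face spheres: `f` in the lower-left block,
a translate of `g` in the upper-right block, basepoint elsewhere. -/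
def fsMul (x₀ : V) (m n : ℕ) (f g : ℕ × ℕ → V) : ℕ × ℕ → V := fun p =>
  if p.1 ≤ m ∧ p.2 ≤ n then f p
  else if m + 1 ≤ p.1 ∧ n + 1 ≤ p.2 then g (p.1 - (m + 1), p.2 - (n + 1))
  else x₀
theorem alpha_contig_aux (m i j : ℕ) (hij : i ≤ j) (hji : j ≤ i + 1) (hjm : j ≤ m) :
    Contiguous (interval (m + 1)) (interval m) (alpha i) (alpha j) := by
  rintro s ⟨h1, h2⟩
  constructor
  · intro x hx
    simp only [Finset.mem_union, Finset.mem_image] at hx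
    rcases hx with ⟨a, ha, rfl⟩ | ⟨a, ha, rfl⟩ <;>
    · have := h1 a ha
      unfold alpha
      split_ifs <;> omega
  · intro x hx y hy
    simp only [Finset.mem_union, Finset.mem_image] at hx hy
    rcases hx with ⟨a, ha, rfl⟩ | ⟨a, ha, rfl⟩ <;> rcases hy with ⟨b, hb, rfl⟩ | ⟨b, hb, rfl⟩ <;>
    · have := h2 a ha b hb
      have := h2 b hb a ha
      unfold alpha
      split_ifs <;> omega

theorem alpha_simp_aux (m i : ℕ) (him : i ≤ m) :
    IsSimplicialMap (interval (m + 1)) (interval m) (alpha i) := by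
  intro s hs
  simpa using alpha_contig_aux m i i le_rfl (by omega) him s hs

/-- `α_i ≃ α_j : I_{m+1} → I_m` for `0 ≤ i < j ≤ m`. -/
theorem alpha_contigEquiv (m i j : ℕ) (hij : i < j) (hjm : j ≤ m) :
    ContigEquiv (interval (m + 1)) (interval m) (alpha i) (alpha j) := by
  induction j, hij using Nat.le_induction with
  | base =>
    exact Relation.ReflTransGen.single ⟨alpha_simp_aux m i (by omega),
      alpha_simp_aux m _ hjm, alpha_contig_aux m _ _ (by omega) (by omega) hjm⟩
  | succ k hk ih =>
    exact Relation.ReflTransGen.tail (ih (by omega)) ⟨alpha_simp_aux m k (by omega),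
      alpha_simp_aux m _ hjm, alpha_contig_aux m _ _ (by omega) (by omega) hjm⟩
end

section
/- For any based simplicial complex (X, x₀), the map Φ : F(X, x₀) → π₂(|X|, x₀) defined by Φ([g]) = [|g∘E|], where E : I_{m,n} → I_m × I_n is the vertex-identification simplicial map (i/m, j/n) ↦ (i, j), is a well-defined group isomorphism between the face group of X and the second homotopy group of the geometric realization of X. -/
variable {U V W : Type}

noncomputable section
open Set

/-- The triangulation `I_{m,n}` of the unit square: vertices `(i,j)` (standing for
`(i/m, j/n)`), each grid square cut by the lower-left-to-upper-right diagonal. -/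
def gridComplex (m n : ℕ) : ASC (ℕ × ℕ) where
  faces := {s | ∃ i j, i + 1 ≤ m ∧ j + 1 ≤ n ∧
    (s ⊆ {(i, j), (i + 1, j), (i + 1, j + 1)} ∨ s ⊆ {(i, j), (i, j + 1), (i + 1, j + 1)})}
  down_closed := by
    rintro s t ⟨i, j, hi, hj, h⟩ hts
    exact ⟨i, j, hi, hj, h.imp hts.trans hts.trans⟩

/-- Barycentric coordinates of a point of the unit square with respect to the
triangulation `I_{m,n}`. -/
noncomputable def bary (m n : ℕ) (y : ℝ × ℝ) : ℕ × ℕ → ℝ := fun p =>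
  let u : ℝ := m * y.1
  let v : ℝ := n * y.2
  let i : ℕ := ⌊u⌋₊
  let j : ℕ := ⌊v⌋₊
  let a : ℝ := u - (i : ℝ)
  let b : ℝ := v - (j : ℝ)
  if b ≤ a then
    (if p = (i, j) then 1 - a else 0) + (if p = (i + 1, j) then a - b else 0) +
      (if p = (i + 1, j + 1) then b else 0)
  else
    (if p = (i, j) then 1 - b else 0) + (if p = (i, j + 1) then b - a else 0) +
      (if p = (i + 1, j + 1) then a else 0)

/-- The geometric realization of a simplicial complex, as a subset of `V → ℝ`
(barycentric coordinates). -/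
def realization (K : ASC V) : Set (V → ℝ) :=
  {w | (∀ v, 0 ≤ w v) ∧ ∃ s ∈ K.faces, (∀ v, v ∉ s → w v = 0) ∧ ∑ v ∈ s, w v = 1}

/-- The realization `|g|` of a vertex map `g` on the triangulation `I_{m,n}`,
as a map from the unit square to barycentric coordinates on the target. -/
noncomputable def gridRealize (g : ℕ × ℕ → V) (m n : ℕ) (y : ℝ × ℝ) : V → ℝ :=
  fun u => ∑ᶠ p ∈ {p : ℕ × ℕ | g p = u}, bary m n y p

def unitSquare : Set (ℝ × ℝ) := Icc (0 : ℝ) 1 ×ˢ Icc (0 : ℝ) 1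

def squareBdry : Set (ℝ × ℝ) :=
  {y ∈ unitSquare | y.1 = 0 ∨ y.1 = 1 ∨ y.2 = 0 ∨ y.2 = 1}

/-- The point of `|X|` corresponding to the vertex `x₀`. -/
def vertexPoint [DecidableEq V] (x₀ : V) : V → ℝ := fun v => if v = x₀ then 1 else 0

/-- A continuous map of pairs `(I², ∂I²) → (|X|, x₀)`. -/
def IsSphereMap [DecidableEq V] (X : ASC V) (x₀ : V) (f : ℝ × ℝ → V → ℝ) : Prop :=
  ContinuousOn f unitSquare ∧ (∀ y ∈ unitSquare, f y ∈ realization X) ∧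
    ∀ y ∈ squareBdry, f y = vertexPoint x₀

/-- `g` is a simplicial approximation to `f`: for every `y` in the square,
`|g|(y)` lies in the carrier of `f(y)` (supports are nested). -/
def IsSimpApprox (X : ASC V) (m n : ℕ) (g : ℕ × ℕ → V) (f : ℝ × ℝ → V → ℝ) : Prop :=
  ∀ y ∈ unitSquare, ∀ u : V, gridRealize g m n y u ≠ 0 → f y u ≠ 0

/-- A simplicial map of pairs `(I_{m,n}, ∂I_{m,n}) → (X, x₀)`. -/
def IsGridSphere [DecidableEq V] (X : ASC V) (x₀ : V) (m n : ℕ) (g : ℕ × ℕ → V) : Prop :=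
  IsSimplicialMap (gridComplex m n) X g ∧
  ∀ p : ℕ × ℕ, p.1 ≤ m → p.2 ≤ n →
    (p.1 = 0 ∨ p.1 = m ∨ p.2 = 0 ∨ p.2 = n) → g p = x₀

/-- Homotopy relative the boundary between two maps `(I², ∂I²) → (|X|, x₀)`. -/
def HtpyRelBdry (X : ASC V) (F G : ℝ × ℝ → V → ℝ) : Prop :=
  ∃ H : (ℝ × ℝ) × ℝ → V → ℝ,
    ContinuousOn H (unitSquare ×ˢ Icc (0 : ℝ) 1) ∧
    (∀ p ∈ unitSquare ×ˢ Icc (0 : ℝ) 1, H p ∈ realization X) ∧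
    (∀ y ∈ unitSquare, H (y, 0) = F y) ∧
    (∀ y ∈ unitSquare, H (y, 1) = G y) ∧
    (∀ y ∈ squareBdry, ∀ t ∈ Icc (0 : ℝ) 1, H (y, t) = F y)

/-- The vertex map of the subdivision map `ρ_k : I_{km,kn} → I_{m,n}`. -/
def rho (k : ℕ) : ℕ × ℕ → ℕ × ℕ := fun p => (p.1 / k, p.2 / k)

/-- Horizontal concatenation of maps `(I², ∂I²) → (|X|, x₀)`: the product in `π₂`. -/
noncomputable def hcat (F G : ℝ × ℝ → V → ℝ) : ℝ × ℝ → V → ℝ := fun y =>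
  if y.1 ≤ 1 / 2 then F (2 * y.1, y.2) else G (2 * y.1 - 1, y.2)

end
/-! helper material -/
noncomputable section HelperStuff
open Set
set_option linter.unusedSectionVars false
set_option linter.unusedVariables false

def hat (x y : ℝ) : ℝ := max 0 (min (1 - |x|) (min (1 - |y|) (1 - |x - y|)))

def gbox (m n : ℕ) : Finset (ℕ × ℕ) := Finset.range (m + 1) ×ˢ Finset.range (n + 1)

theorem mem_gbox {m n : ℕ} {p : ℕ × ℕ} : p ∈ gbox m n ↔ p.1 ≤ m ∧ p.2 ≤ n := by
  simp [gbox]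

def tri (u v : ℝ) : ℕ × ℕ → ℝ := fun p =>
  let i : ℕ := ⌊u⌋₊
  let j : ℕ := ⌊v⌋₊
  let a : ℝ := u - (i : ℝ)
  let b : ℝ := v - (j : ℝ)
  if b ≤ a then
    (if p = (i, j) then 1 - a else 0) + (if p = (i + 1, j) then a - b else 0) +
      (if p = (i + 1, j + 1) then b else 0)
  else
    (if p = (i, j) then 1 - b else 0) + (if p = (i, j + 1) then b - a else 0) +
      (if p = (i + 1, j + 1) then a else 0)

theorem hat_nonneg (x y : ℝ) : 0 ≤ hat x y := le_max_left _ _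

theorem hat_ne_zero {x y : ℝ} (h : hat x y ≠ 0) : |x| < 1 ∧ |y| < 1 := by
  unfold hat at h
  constructor
  · by_contra hx
    apply h
    apply max_eq_left
    refine (min_le_left _ _).trans ?_
    linarith
  · by_contra hx
    apply h
    apply max_eq_left
    refine (min_le_right _ _).trans ((min_le_left _ _).trans ?_)
    linarith

theorem hat_zero_of {x y : ℝ} (h : 1 ≤ |x| ∨ 1 ≤ |y| ∨ 1 ≤ |x - y|) : hat x y = 0 := by
  unfold hat
  apply max_eq_left
  rcases h with h | h | h
  · exact (min_le_left _ _).trans (by linarith)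
  · exact (min_le_right _ _).trans ((min_le_left _ _).trans (by linarith))
  · exact (min_le_right _ _).trans ((min_le_right _ _).trans (by linarith))

theorem hat_eq_of {x y c : ℝ} (hc : 0 ≤ c) (h1 : |x| ≤ 1 - c) (h2 : |y| ≤ 1 - c)
    (h3 : |x - y| ≤ 1 - c) (h : |x| = 1 - c ∨ |y| = 1 - c ∨ |x - y| = 1 - c) : hat x y = c := by
  unfold hat
  have : min (1 - |x|) (min (1 - |y|) (1 - |x - y|)) = c := by
    apply le_antisymm
    · rcases h with h | h | h
      · exact (min_le_left _ _).trans (by linarith)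
      · exact (min_le_right _ _).trans ((min_le_left _ _).trans (by linarith))
      · exact (min_le_right _ _).trans ((min_le_right _ _).trans (by linarith))
    · refine le_min (by linarith) (le_min (by linarith) (by linarith))
  rw [this, max_eq_right hc]

theorem ite_cond_split (c : Prop) [Decidable c] (x y z : ℝ) (h1 : c → x = z)
    (h2 : ¬ c → y = z) : (if c then x else y) = z := by
  split_ifs with h
  · exact h1 h
  · exact h2 h

theorem tri_eq_hat {u v : ℝ} (hu : 0 ≤ u) (hv : 0 ≤ v) (p : ℕ × ℕ) :
    tri u v p = hat (u - p.1) (v - p.2) := by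
  obtain ⟨P, Q⟩ := p
  have hi := Nat.floor_le hu
  have hi' := Nat.lt_floor_add_one u
  have hj := Nat.floor_le hv
  have hj' := Nat.lt_floor_add_one v
  unfold tri
  generalize ⌊u⌋₊ = i at *
  generalize ⌊v⌋₊ = j at *
  simp only [Prod.mk.injEq]
  -- the trivial outside cases
  rcases lt_or_ge P i with hP | hP
  · have : (P : ℝ) + 1 ≤ i := by exact_mod_cast hP
    rw [hat_zero_of (Or.inl (by rw [le_abs]; left; linarith))]
    have h1 : ¬ P = i := by omega
    have h2 : ¬ P = i + 1 := by omega
    simp [h1, h2]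
  rcases lt_or_ge (i + 1) P with hP2 | hP2
  · have : (i : ℝ) + 1 + 1 ≤ P := by exact_mod_cast hP2
    rw [hat_zero_of (Or.inl (by rw [le_abs]; right; linarith))]
    have h1 : ¬ P = i := by omega
    have h2 : ¬ P = i + 1 := by omega
    simp [h1, h2]
  rcases lt_or_ge Q j with hQ | hQ
  · have : (Q : ℝ) + 1 ≤ j := by exact_mod_cast hQ
    rw [hat_zero_of (Or.inr (Or.inl (by rw [le_abs]; left; linarith)))]
    have h1 : ¬ Q = j := by omega
    have h2 : ¬ Q = j + 1 := by omega
    simp [h1, h2]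
  rcases lt_or_ge (j + 1) Q with hQ2 | hQ2
  · have : (j : ℝ) + 1 + 1 ≤ Q := by exact_mod_cast hQ2
    rw [hat_zero_of (Or.inr (Or.inl (by rw [le_abs]; right; linarith)))]
    have h1 : ¬ Q = j := by omega
    have h2 : ¬ Q = j + 1 := by omega
    simp [h1, h2]
  have hP3 : P = i ∨ P = i + 1 := by omega
  have hQ3 : Q = j ∨ Q = j + 1 := by omega
  rcases hP3 with rfl | rfl <;> rcases hQ3 with rfl | rfl
  all_goals
    refine (ite_cond_split _ _ _ _ (fun hab => ?_) (fun hab => ?_)) <;>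
      simp <;> symm
  · apply hat_eq_of
    · linarith
    · rw [abs_le]; constructor <;> linarith
    · rw [abs_le]; constructor <;> linarith
    · rw [abs_le]; constructor <;> linarith
    · left; rw [abs_of_nonneg] <;> linarith
  · apply hat_eq_of
    · linarith
    · rw [abs_le]; constructor <;> linarith
    · rw [abs_le]; constructor <;> linarith
    · rw [abs_le]; constructor <;> linarith
    · right; left; rw [abs_of_nonneg] <;> linarith
  · apply hat_zero_of
    right; right; rw [le_abs]; left; linarith
  · apply hat_eq_of
    · linarith
    · rw [abs_le]; constructor <;> linarith
    · rw [abs_le]; constructor <;> linarith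
    · rw [abs_le]; constructor <;> linarith
    · right; right; rw [abs_of_nonneg] <;> linarith
  · apply hat_eq_of
    · linarith
    · rw [abs_le]; constructor <;> linarith
    · rw [abs_le]; constructor <;> linarith
    · rw [abs_le]; constructor <;> linarith
    · right; right; rw [abs_of_nonpos] <;> linarith
  · apply hat_zero_of
    right; right; rw [le_abs]; right; linarith
  · apply hat_eq_of
    · linarith
    · rw [abs_le]; constructor <;> linarith
    · rw [abs_le]; constructor <;> linarith
    · rw [abs_le]; constructor <;> linarith
    · right; left; rw [abs_of_nonpos] <;> linarith
  · apply hat_eq_of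
    · linarith
    · rw [abs_le]; constructor <;> linarith
    · rw [abs_le]; constructor <;> linarith
    · rw [abs_le]; constructor <;> linarith
    · left; rw [abs_of_nonpos] <;> linarith

/-- scaled box -/
def InBox (m n : ℕ) (z : ℝ × ℝ) : Prop := 0 ≤ z.1 ∧ z.1 ≤ m ∧ 0 ≤ z.2 ∧ z.2 ≤ n

theorem tri_zero_out {m n : ℕ} {z : ℝ × ℝ} (hz : InBox m n z) {p : ℕ × ℕ}
    (hp : p ∉ gbox m n) : tri z.1 z.2 p = 0 := by
  obtain ⟨h1, h2, h3, h4⟩ := hz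
  rw [tri_eq_hat h1 h3]
  rw [mem_gbox] at hp
  apply hat_zero_of
  rcases lt_or_ge m p.1 with h | h
  · left
    have : (m : ℝ) + 1 ≤ p.1 := by exact_mod_cast h
    rw [le_abs]; right; linarith
  · have h' : n + 1 ≤ p.2 := by omega
    have : (n : ℝ) + 1 ≤ p.2 := by exact_mod_cast h'
    right; left
    rw [le_abs]; right; linarith

theorem tri_sum {m n : ℕ} {z : ℝ × ℝ} (hz : InBox m n z) :
    ∑ p ∈ gbox m n, tri z.1 z.2 p = 1 := by
  have hsub : ∀ T : Finset (ℕ × ℕ), gbox m n ⊆ T →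
      ∑ p ∈ gbox m n, tri z.1 z.2 p = ∑ p ∈ T, tri z.1 z.2 p := fun T hT =>
    Finset.sum_subset hT fun p _ hp => tri_zero_out hz hp
  set i := ⌊z.1⌋₊ with hi
  set j := ⌊z.2⌋₊ with hj
  rw [hsub (gbox (max m (i + 1)) (max n (j + 1)))
    (fun p hp => by rw [mem_gbox] at hp ⊢; simp only [le_max_iff]; tauto)]
  unfold tri
  simp only [← hi, ← hj]
  have m1 : (i, j) ∈ gbox (max m (i + 1)) (max n (j + 1)) := by
    rw [mem_gbox]; simp only [le_max_iff]; omega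
  have m2 : (i + 1, j) ∈ gbox (max m (i + 1)) (max n (j + 1)) := by
    rw [mem_gbox]; simp only [le_max_iff]; omega
  have m3 : (i, j + 1) ∈ gbox (max m (i + 1)) (max n (j + 1)) := by
    rw [mem_gbox]; simp only [le_max_iff]; omega
  have m4 : (i + 1, j + 1) ∈ gbox (max m (i + 1)) (max n (j + 1)) := by
    rw [mem_gbox]; simp only [le_max_iff]; omega
  split_ifs with h
  · simp only [Finset.sum_add_distrib, Finset.sum_ite_eq', m1, m2, m4, if_true]
    ring
  · simp only [Finset.sum_add_distrib, Finset.sum_ite_eq', m1, m3, m4, if_true]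
    ring

variable [DecidableEq V]

/-- realization in scaled coordinates -/
def hr (f : ℕ × ℕ → V) (m n : ℕ) (z : ℝ × ℝ) : V → ℝ := fun x =>
  ∑ p ∈ gbox m n, if f p = x then hat (z.1 - p.1) (z.2 - p.2) else 0

theorem hr_continuous (f : ℕ × ℕ → V) (m n : ℕ) : Continuous (hr f m n) := by
  refine continuous_pi fun x => ?_
  unfold hr
  refine continuous_finsetSum _ fun p _ => ?_
  split_ifs
  · unfold hat
    fun_prop
  · exact continuous_const

theorem inBox_of {m n : ℕ} {y : ℝ × ℝ} (hy : y ∈ unitSquare) :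
    InBox m n (m * y.1, n * y.2) := by
  obtain ⟨⟨h1, h2⟩, h3, h4⟩ := hy
  have hm : (0 : ℝ) ≤ m := Nat.cast_nonneg m
  have hn : (0 : ℝ) ≤ n := Nat.cast_nonneg n
  exact ⟨by positivity, by nlinarith, by positivity, by nlinarith⟩

theorem gridRealize_eq (f : ℕ × ℕ → V) {m n : ℕ} {y : ℝ × ℝ} (hy : y ∈ unitSquare) :
    gridRealize f m n y = hr f m n (m * y.1, n * y.2) := by
  have hb := inBox_of (m := m) (n := n) hy
  have hbt : ∀ p, bary m n y p = tri (m * y.1) (n * y.2) p := fun p => rfl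
  funext x
  unfold gridRealize hr
  rw [finsum_mem_def, finsum_eq_sum_of_support_subset (s := gbox m n)]
  · refine Finset.sum_congr rfl fun p _ => ?_
    rw [Set.indicator_apply]
    simp only [mem_ofPred_eq]
    split_ifs
    · rw [hbt, tri_eq_hat hb.1 hb.2.2.1]
    · rfl
  · intro p hp
    by_contra hpb
    apply hp
    rw [Set.indicator_apply, hbt, tri_zero_out hb (by simpa using hpb)]
    simp

def OnS (s : Finset V) (w : V → ℝ) : Prop :=
  (∀ v, 0 ≤ w v) ∧ (∀ v, v ∉ s → w v = 0) ∧ ∑ v ∈ s, w v = 1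

theorem OnS.mem {X : ASC V} {s : Finset V} {w : V → ℝ} (h : OnS s w) (hs : s ∈ X.faces) :
    w ∈ realization X := ⟨h.1, s, hs, h.2.1, h.2.2⟩

theorem hr_ne {f : ℕ × ℕ → V} {m n : ℕ} {z : ℝ × ℝ} {x : V} (h : hr f m n z x ≠ 0) :
    ∃ p : ℕ × ℕ, p.1 ≤ m ∧ p.2 ≤ n ∧ |z.1 - p.1| < 1 ∧ |z.2 - p.2| < 1 ∧ f p = x := by
  obtain ⟨p, hp, hne⟩ := Finset.exists_ne_zero_of_sum_ne_zero h
  split_ifs at hne with hf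
  · rw [mem_gbox] at hp
    exact ⟨p, hp.1, hp.2, (hat_ne_zero hne).1, (hat_ne_zero hne).2, hf⟩
  · exact absurd rfl hne

theorem hr_onS {f : ℕ × ℕ → V} {m n : ℕ} {z : ℝ × ℝ} (hz : InBox m n z) {s : Finset V}
    (h : ∀ p : ℕ × ℕ, p.1 ≤ m → p.2 ≤ n → |z.1 - p.1| < 1 → |z.2 - p.2| < 1 → f p ∈ s) :
    OnS s (hr f m n z) := by
  refine ⟨fun v => ?_, fun v hv => ?_, ?_⟩
  · refine Finset.sum_nonneg fun p _ => ?_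
    split_ifs
    · exact hat_nonneg _ _
    · exact le_rfl
  · by_contra hne
    obtain ⟨p, h1, h2, h3, h4, rfl⟩ := hr_ne hne
    exact hv (h p h1 h2 h3 h4)
  · unfold hr
    rw [Finset.sum_comm, ← tri_sum hz]
    refine Finset.sum_congr rfl fun p hp => ?_
    rw [Finset.sum_ite_eq, tri_eq_hat hz.1 hz.2.2.1]
    split_ifs with hs
    · rfl
    · by_contra hne
      have hne' := hat_ne_zero (Ne.symm hne)
      rw [mem_gbox] at hp
      exact hs (h p hp.1 hp.2 hne'.1 hne'.2)

theorem OnS_singleton {x₀ : V} {w : V → ℝ} : OnS {x₀} w ↔ w = vertexPoint x₀ := by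
  constructor
  · rintro ⟨_, h2, h3⟩
    funext v
    unfold vertexPoint
    split_ifs with hv
    · subst hv; simpa using h3
    · exact h2 v (by simpa using hv)
  · rintro rfl
    refine ⟨fun v => ?_, fun v hv => ?_, ?_⟩
    · unfold vertexPoint; split_ifs <;> norm_num
    · unfold vertexPoint; rw [if_neg]; simpa using hv
    · simp [vertexPoint]

theorem near_face (m n : ℕ) (z : ℝ × ℝ) (s : Finset (ℕ × ℕ))
    (h : ∀ p ∈ s, p.1 ≤ m ∧ p.2 ≤ n ∧ |z.1 - p.1| < 1 ∧ |z.2 - p.2| < 1) :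
    s ∈ (prodInterval m n).faces := by
  refine ⟨⟨?_, ?_⟩, ⟨?_, ?_⟩⟩
  · intro x hx
    obtain ⟨p, hp, rfl⟩ := Finset.mem_image.1 hx
    exact (h p hp).1
  · intro x hx y hy
    obtain ⟨p, hp, rfl⟩ := Finset.mem_image.1 hx
    obtain ⟨q, hq, rfl⟩ := Finset.mem_image.1 hy
    have h1 := abs_lt.1 (h p hp).2.2.1
    have h2 := abs_lt.1 (h q hq).2.2.1
    have : (p.1 : ℝ) < (q.1 : ℝ) + 2 := by linarith
    have : p.1 < q.1 + 2 := by exact_mod_cast this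
    omega
  · intro x hx
    obtain ⟨p, hp, rfl⟩ := Finset.mem_image.1 hx
    exact (h p hp).2.1
  · intro x hx y hy
    obtain ⟨p, hp, rfl⟩ := Finset.mem_image.1 hx
    obtain ⟨q, hq, rfl⟩ := Finset.mem_image.1 hy
    have h1 := abs_lt.1 (h p hp).2.2.2
    have h2 := abs_lt.1 (h q hq).2.2.2
    have : (p.2 : ℝ) < (q.2 : ℝ) + 2 := by linarith
    have : p.2 < q.2 + 2 := by exact_mod_cast this
    omega

/-- the carrier cell of a point -/
def cellOf (m n : ℕ) (z : ℝ × ℝ) : Finset (ℕ × ℕ) :=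
  open Classical in (gbox m n).filter fun p => |z.1 - p.1| < 1 ∧ |z.2 - p.2| < 1

theorem mem_cellOf {m n : ℕ} {z : ℝ × ℝ} {p : ℕ × ℕ} : p ∈ cellOf m n z ↔
    p.1 ≤ m ∧ p.2 ≤ n ∧ |z.1 - p.1| < 1 ∧ |z.2 - p.2| < 1 := by
  unfold cellOf
  rw [Finset.mem_filter, mem_gbox]
  tauto

theorem cellOf_face (m n : ℕ) (z : ℝ × ℝ) : cellOf m n z ∈ (prodInterval m n).faces :=
  near_face m n z _ fun _ hp => mem_cellOf.1 hp

theorem cellOf_image {X : ASC V} {x₀ : V} {m n : ℕ} {f : ℕ × ℕ → V}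
    (hf : IsFaceSphere X x₀ m n f) (z : ℝ × ℝ) : (cellOf m n z).image f ∈ X.faces :=
  hf.1 _ (cellOf_face m n z)

theorem hr_cell {f : ℕ × ℕ → V} {m n : ℕ} {z : ℝ × ℝ} (hz : InBox m n z) :
    OnS ((cellOf m n z).image f) (hr f m n z) :=
  hr_onS hz fun p h1 h2 h3 h4 =>
    Finset.mem_image_of_mem f (mem_cellOf.2 ⟨h1, h2, h3, h4⟩)

theorem hr_mem {X : ASC V} {x₀ : V} {m n : ℕ} {f : ℕ × ℕ → V}
    (hf : IsFaceSphere X x₀ m n f) {z : ℝ × ℝ} (hz : InBox m n z) :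
    hr f m n z ∈ realization X := (hr_cell hz).mem (cellOf_image hf z)

theorem near_int {u : ℝ} {a b : ℕ} (h : |u - b| < 1) (hu : u = a) : b = a := by
  rw [hu, abs_lt] at h
  have h1 : (b : ℝ) < a + 1 := by linarith
  have h2 : (a : ℝ) < b + 1 := by linarith
  have h1' : b < a + 1 := by exact_mod_cast h1
  have h2' : a < b + 1 := by exact_mod_cast h2
  omega

theorem hr_bdry {X : ASC V} {x₀ : V} {m n : ℕ} {f : ℕ × ℕ → V}
    (hf : IsFaceSphere X x₀ m n f) {z : ℝ × ℝ} (hz : InBox m n z)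
    (h : z.1 = 0 ∨ z.1 = m ∨ z.2 = 0 ∨ z.2 = n) : hr f m n z = vertexPoint x₀ := by
  rw [← OnS_singleton]
  refine hr_onS hz fun p h1 h2 h3 h4 => ?_
  rw [Finset.mem_singleton]
  refine hf.2 p h1 h2 ?_
  rcases h with h | h | h | h
  · left; exact near_int h3 (by simpa using h)
  · right; left; exact near_int h3 h
  · right; right; left; exact near_int h4 (by simpa using h)
  · right; right; right; exact near_int h4 h

theorem sphereMap_of_face {X : ASC V} {x₀ : V} {m n : ℕ} {f : ℕ × ℕ → V}
    (hf : IsFaceSphere X x₀ m n f) : IsSphereMap X x₀ (gridRealize f m n) := by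
  refine ⟨?_, ?_, ?_⟩
  · refine ContinuousOn.congr (f := fun y : ℝ × ℝ => hr f m n (m * y.1, n * y.2)) ?_
      fun y hy => gridRealize_eq f hy
    exact ((hr_continuous f m n).comp (by fun_prop)).continuousOn
  · intro y hy
    rw [gridRealize_eq f hy]
    exact hr_mem hf (inBox_of hy)
  · rintro y ⟨hy, h⟩
    rw [gridRealize_eq f hy]
    refine hr_bdry hf (inBox_of hy) ?_
    rcases h with h | h | h | h <;> simp [h]

theorem gridRealize_cell {m n : ℕ} {f : ℕ × ℕ → V} {y : ℝ × ℝ} (hy : y ∈ unitSquare) :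
    OnS ((cellOf m n (m * y.1, n * y.2)).image f) (gridRealize f m n y) := by
  rw [gridRealize_eq f hy]; exact hr_cell (inBox_of hy)

theorem htpy_line {X : ASC V} {F G : ℝ × ℝ → V → ℝ} (hF : ContinuousOn F unitSquare)
    (hG : ContinuousOn G unitSquare)
    (h : ∀ y ∈ unitSquare, ∃ s ∈ X.faces, OnS s (F y) ∧ OnS s (G y))
    (hb : ∀ y ∈ squareBdry, F y = G y) : HtpyRelBdry X F G := by
  refine ⟨fun p => (1 - p.2) • F p.1 + p.2 • G p.1, ?_, ?_, ?_, ?_, ?_⟩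
  · have h1 : ContinuousOn (fun p : (ℝ × ℝ) × ℝ => F p.1) (unitSquare ×ˢ Icc (0 : ℝ) 1) :=
      hF.comp continuousOn_fst fun p hp => hp.1
    have h2 : ContinuousOn (fun p : (ℝ × ℝ) × ℝ => G p.1) (unitSquare ×ˢ Icc (0 : ℝ) 1) :=
      hG.comp continuousOn_fst fun p hp => hp.1
    exact ((continuousOn_const.sub continuousOn_snd).smul h1).add (continuousOn_snd.smul h2)
  · rintro ⟨y, t⟩ ⟨hy, ht0, ht1⟩
    obtain ⟨s, hs, a, b⟩ := h y hy
    simp only at ht0 ht1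
    refine OnS.mem (s := s) ⟨fun v => ?_, fun v hv => ?_, ?_⟩ hs
    · simp only [Pi.add_apply, Pi.smul_apply, smul_eq_mul]
      have := a.1 v
      have := b.1 v
      have : 0 ≤ 1 - t := by linarith
      positivity
    · simp [a.2.1 v hv, b.2.1 v hv]
    · simp only [Pi.add_apply, Pi.smul_apply, smul_eq_mul]
      rw [Finset.sum_add_distrib, ← Finset.mul_sum, ← Finset.mul_sum, a.2.2, b.2.2]
      ring
  · intro y _; simp
  · intro y _; simp
  · intro y hy t _
    funext v
    simp only [hb y hy, Pi.add_apply, Pi.smul_apply, smul_eq_mul]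
    ring

theorem htpy_symm {X : ASC V} {F G : ℝ × ℝ → V → ℝ} (h : HtpyRelBdry X F G) :
    HtpyRelBdry X G F := by
  obtain ⟨H, hc, hm, h0, h1, hb⟩ := h
  have hmaps : ∀ p ∈ unitSquare ×ˢ Icc (0 : ℝ) 1,
      ((p.1, 1 - p.2) : (ℝ × ℝ) × ℝ) ∈ unitSquare ×ˢ Icc (0 : ℝ) 1 := by
    rintro ⟨y, t⟩ ⟨hy, ht0, ht1⟩
    simp only at ht0 ht1
    exact ⟨hy, by simpa using ht1, by simpa using ht0⟩
  refine ⟨fun p => H (p.1, 1 - p.2), hc.comp (by fun_prop) hmaps, fun p hp => hm _ (hmaps p hp),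
    fun y hy => by simpa using h1 y hy, fun y hy => by simpa using h0 y hy, ?_⟩
  intro y hy t ht
  have e1 := hb y hy (1 - t) ⟨by linarith [ht.2], by linarith [ht.1]⟩
  have e2 := hb y hy 1 ⟨zero_le_one, le_rfl⟩
  rw [h1 y hy.1] at e2
  simp only [e1, e2]

theorem htpy_trans {X : ASC V} {F G K : ℝ × ℝ → V → ℝ} (h : HtpyRelBdry X F G)
    (h' : HtpyRelBdry X G K) : HtpyRelBdry X F K := by
  obtain ⟨H, hc, hm, h0, h1, hb⟩ := h
  obtain ⟨H', hc', hm', h0', h1', hb'⟩ := h'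
  have m1 : ∀ p ∈ unitSquare ×ˢ Icc (0 : ℝ) 1,
      ((p.1, min (2 * p.2) 1) : (ℝ × ℝ) × ℝ) ∈ unitSquare ×ˢ Icc (0 : ℝ) 1 := by
    rintro ⟨y, t⟩ ⟨hy, ht0, ht1⟩
    simp only at ht0 ht1
    exact ⟨hy, le_min (by simpa using ht0) zero_le_one, min_le_right _ _⟩
  have m2 : ∀ p ∈ unitSquare ×ˢ Icc (0 : ℝ) 1,
      ((p.1, max (2 * p.2 - 1) 0) : (ℝ × ℝ) × ℝ) ∈ unitSquare ×ˢ Icc (0 : ℝ) 1 := by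
    rintro ⟨y, t⟩ ⟨hy, ht0, ht1⟩
    simp only at ht0 ht1
    exact ⟨hy, le_max_right _ _, max_le (by simp only; linarith) zero_le_one⟩
  have m3 : ∀ p ∈ unitSquare ×ˢ Icc (0 : ℝ) 1,
      ((p.1, 1) : (ℝ × ℝ) × ℝ) ∈ unitSquare ×ˢ Icc (0 : ℝ) 1 := by
    rintro ⟨y, t⟩ ⟨hy, _⟩
    exact ⟨hy, zero_le_one, le_rfl⟩
  have low : ∀ y ∈ unitSquare, ∀ t : ℝ, t ≤ 1 / 2 →
      H (y, min (2 * t) 1) + H' (y, max (2 * t - 1) 0) - H (y, 1) = H (y, 2 * t) := by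
    intro y hy t ht
    rw [min_eq_left (by linarith), max_eq_right (by linarith), h0' y hy, h1 y hy]
    simp
  have high : ∀ y ∈ unitSquare, ∀ t : ℝ, 1 / 2 ≤ t →
      H (y, min (2 * t) 1) + H' (y, max (2 * t - 1) 0) - H (y, 1) = H' (y, 2 * t - 1) := by
    intro y hy t ht
    rw [min_eq_right (by linarith), max_eq_left (by linarith)]
    simp
  refine ⟨fun p => H (p.1, min (2 * p.2) 1) + H' (p.1, max (2 * p.2 - 1) 0) - H (p.1, 1),
    ?_, ?_, ?_, ?_, ?_⟩
  · exact ((hc.comp (by fun_prop) m1).add (hc'.comp (by fun_prop) m2)).sub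
      (hc.comp (by fun_prop) m3)
  · rintro ⟨y, t⟩ ⟨hy, ht0, ht1⟩
    simp only at ht0 ht1
    rcases le_total t (1 / 2) with h | h
    · simp only [low y hy t h]
      exact hm _ ⟨hy, by simpa using ht0, by simp only; linarith⟩
    · simp only [high y hy t h]
      exact hm' _ ⟨hy, by simp only; linarith, by simp only; linarith⟩
  · intro y hy
    simp only [low y hy 0 (by norm_num)]
    rw [mul_zero, h0 y hy]
  · intro y hy
    simp only [high y hy 1 (by norm_num)]
    rw [← h1' y hy]; norm_num
  · intro y hy t ht
    rcases le_total t (1 / 2) with h | h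
    · simp only [low y hy.1 t h]
      exact hb y hy _ ⟨by linarith [ht.1], by linarith⟩
    · simp only [high y hy.1 t h]
      rw [hb' y hy _ ⟨by linarith, by linarith [ht.2]⟩, ← h1 y hy.1]
      exact hb y hy _ ⟨zero_le_one, le_rfl⟩

theorem htpy_contig {X : ASC V} {x₀ : V} {m n : ℕ} {f g : ℕ × ℕ → V}
    (hf : IsFaceSphere X x₀ m n f) (hg : IsFaceSphere X x₀ m n g)
    (h : Contiguous (prodInterval m n) X f g) :
    HtpyRelBdry X (gridRealize f m n) (gridRealize g m n) := by
  have sf := sphereMap_of_face hf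
  have sg := sphereMap_of_face hg
  refine htpy_line sf.1 sg.1 (fun y hy => ?_) fun y hy => by rw [sf.2.2 y hy, sg.2.2 y hy]
  refine ⟨_, h _ (cellOf_face m n (m * y.1, n * y.2)), ?_, ?_⟩
  · rw [gridRealize_eq f hy]
    exact hr_onS (inBox_of hy) fun p h1 h2 h3 h4 => Finset.mem_union_left _
      (Finset.mem_image_of_mem f (mem_cellOf.2 ⟨h1, h2, h3, h4⟩))
  · rw [gridRealize_eq g hy]
    exact hr_onS (inBox_of hy) fun p h1 h2 h3 h4 => Finset.mem_union_right _
      (Finset.mem_image_of_mem g (mem_cellOf.2 ⟨h1, h2, h3, h4⟩))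

theorem htpy_refl {X : ASC V} {x₀ : V} {m n : ℕ} {f : ℕ × ℕ → V}
    (hf : IsFaceSphere X x₀ m n f) :
    HtpyRelBdry X (gridRealize f m n) (gridRealize f m n) :=
  htpy_contig hf hf fun s hs => by rw [Finset.union_self]; exact hf.1 s hs

theorem htpy_faceContig {X : ASC V} {x₀ : V} {m n : ℕ} {f g : ℕ × ℕ → V}
    (hf : IsFaceSphere X x₀ m n f) (h : FaceContigEquiv X x₀ m n f g) :
    HtpyRelBdry X (gridRealize f m n) (gridRealize g m n) := by
  induction h with
  | refl => exact htpy_refl hf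
  | tail _ h ih => exact htpy_trans ih (htpy_contig h.1 h.2.1 h.2.2)

theorem alpha_iter (m r x : ℕ) (hx : x ≤ m + r) : (alpha m)^[r] x = min x m := by
  induction r generalizing x with
  | zero => simp; omega
  | succ r ih =>
    rw [Function.iterate_succ_apply]
    unfold alpha at *
    split_ifs with h
    · rw [ih _ (by omega)]
    · rw [ih _ (by omega)]; omega

theorem trivExt_apply {m n M N : ℕ} (hM : m ≤ M) (hN : n ≤ N) (f : ℕ × ℕ → V) {p : ℕ × ℕ}
    (h1 : p.1 ≤ M) (h2 : p.2 ≤ N) :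
    trivExt m n (M - m) (N - n) f p = f (min p.1 m, min p.2 n) := by
  unfold trivExt
  simp only [Function.comp_apply, Prod.map]
  rw [alpha_iter _ _ _ (by omega), alpha_iter _ _ _ (by omega)]

/-- pulling back a face sphere along nice vertex maps -/
theorem mem_prodInterval {m n : ℕ} {s : Finset (ℕ × ℕ)} : s ∈ (prodInterval m n).faces ↔
    ∀ p ∈ s, (p.1 ≤ m ∧ p.2 ≤ n) ∧ ∀ q ∈ s, p.1 ≤ q.1 + 1 ∧ p.2 ≤ q.2 + 1 := by
  constructor
  · rintro ⟨⟨a, b⟩, c, d⟩ p hp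
    refine ⟨⟨a _ (Finset.mem_image_of_mem _ hp), c _ (Finset.mem_image_of_mem _ hp)⟩,
      fun q hq => ⟨b _ (Finset.mem_image_of_mem _ hp) _ (Finset.mem_image_of_mem _ hq),
        d _ (Finset.mem_image_of_mem _ hp) _ (Finset.mem_image_of_mem _ hq)⟩⟩
  · intro h
    refine ⟨⟨?_, ?_⟩, ⟨?_, ?_⟩⟩ <;> simp only [Finset.mem_image]
    · rintro _ ⟨p, hp, rfl⟩; exact (h p hp).1.1
    · rintro _ ⟨p, hp, rfl⟩ _ ⟨q, hq, rfl⟩; exact ((h p hp).2 q hq).1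
    · rintro _ ⟨p, hp, rfl⟩; exact (h p hp).1.2
    · rintro _ ⟨p, hp, rfl⟩ _ ⟨q, hq, rfl⟩; exact ((h p hp).2 q hq).2

/-- step maps -/
def IsStep (M m : ℕ) (φ : ℕ → ℕ) : Prop :=
  φ 0 = 0 ∧ φ M = m ∧ (∀ x ≤ M, φ x ≤ m) ∧ ∀ x ≤ M, ∀ y ≤ M, x ≤ y + 1 → φ x ≤ φ y + 1

theorem faceSphere_pull {X : ASC V} {x₀ : V} {m n M N : ℕ} {f : ℕ × ℕ → V}
    (hf : IsFaceSphere X x₀ m n f) {φ χ : ℕ → ℕ} (hφ : IsStep M m φ) (hχ : IsStep N n χ) :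
    IsFaceSphere X x₀ M N (fun p => f (φ p.1, χ p.2)) := by
  obtain ⟨a0, a1, a2, a3⟩ := hφ
  obtain ⟨b0, b1, b2, b3⟩ := hχ
  constructor
  · intro s hs
    rw [mem_prodInterval] at hs
    have := hf.1 (s.image fun p => (φ p.1, χ p.2)) (by
      rw [mem_prodInterval]
      simp only [Finset.mem_image]
      rintro _ ⟨p, hp, rfl⟩
      obtain ⟨⟨p1, p2⟩, p3⟩ := hs p hp
      refine ⟨⟨a2 _ p1, b2 _ p2⟩, ?_⟩
      rintro _ ⟨q, hq, rfl⟩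
      obtain ⟨⟨q1, q2⟩, _⟩ := hs q hq
      exact ⟨a3 _ p1 _ q1 (p3 q hq).1, b3 _ p2 _ q2 (p3 q hq).2⟩)
    rw [Finset.image_image] at this
    exact this
  · intro p h1 h2 h
    refine hf.2 _ (a2 _ h1) (b2 _ h2) ?_
    rcases h with h | h | h | h <;> simp only [h, a0, a1, b0, b1, true_or, or_true]

theorem faceSphere_congr {X : ASC V} {x₀ : V} {m n : ℕ} {f g : ℕ × ℕ → V}
    (hf : IsFaceSphere X x₀ m n f) (h : ∀ p : ℕ × ℕ, p.1 ≤ m → p.2 ≤ n → g p = f p) :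
    IsFaceSphere X x₀ m n g := by
  constructor
  · intro s hs
    have := hf.1 s hs
    rw [mem_prodInterval] at hs
    rwa [Finset.image_congr (g := f)]
    intro p hp
    exact h p (hs p hp).1.1 (hs p hp).1.2
  · intro p h1 h2 h3
    rw [h p h1 h2]; exact hf.2 p h1 h2 h3

theorem contig_congr {X : ASC V} {x₀ : V} {m n : ℕ} {f g : ℕ × ℕ → V}
    (hf : IsFaceSphere X x₀ m n f) (h : ∀ p : ℕ × ℕ, p.1 ≤ m → p.2 ≤ n → g p = f p) :
    FaceContigEquiv X x₀ m n f g := by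
  refine Relation.ReflTransGen.single ⟨hf, faceSphere_congr hf h, ?_⟩
  intro s hs
  have := hf.1 s hs
  rw [mem_prodInterval] at hs
  rw [Finset.image_congr (f := g) (g := f), Finset.union_self]
  · exact this
  · intro p hp
    exact h p (hs p hp).1.1 (hs p hp).1.2

theorem isStep_min {M m : ℕ} (h : m ≤ M) : IsStep M m (fun x => min x m) := by
  refine ⟨?_, ?_, ?_, ?_⟩ <;> intros <;> simp only <;> omega

theorem faceSphere_trivExt {X : ASC V} {x₀ : V} {m n M N : ℕ} {f : ℕ × ℕ → V}
    (hf : IsFaceSphere X x₀ m n f) (hM : m ≤ M) (hN : n ≤ N) :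
    IsFaceSphere X x₀ M N (trivExt m n (M - m) (N - n) f) :=
  faceSphere_congr (faceSphere_pull hf (isStep_min hM) (isStep_min hN))
    fun _ h1 h2 => trivExt_apply hM hN f h1 h2

theorem contig_symm {X : ASC V} {x₀ : V} {m n : ℕ} {f g : ℕ × ℕ → V}
    (h : FaceContigEquiv X x₀ m n f g) : FaceContigEquiv X x₀ m n g f := by
  induction h with
  | refl => exact Relation.ReflTransGen.refl
  | tail _ h ih =>
    refine Relation.ReflTransGen.head ⟨h.2.1, h.1, ?_⟩ ih
    intro s hs
    rw [Finset.union_comm]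
    exact h.2.2 s hs

/-- a sphere map precomposed with step maps is contiguity equivalent to the trivial extension -/
theorem contig_step {X : ASC V} {x₀ : V} {m n M N : ℕ} {f : ℕ × ℕ → V}
    (hf : IsFaceSphere X x₀ m n f) (hM : m ≤ M) (hN : n ≤ N) {φ χ : ℕ → ℕ}
    (hφ : IsStep M m φ) (hχ : IsStep N n χ) :
    FaceContigEquiv X x₀ M N (fun p => f (φ p.1, χ p.2))
      (trivExt m n (M - m) (N - n) f) := by
  have lek : ∀ {M m : ℕ} {φ : ℕ → ℕ}, m ≤ M → IsStep M m φ → ∀ x ≤ M, φ x ≤ x := by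
    intro M m φ _ h x
    induction x with
    | zero => intro _; rw [h.1]
    | succ x ih =>
      intro hx
      have := ih (by omega)
      have := h.2.2.2 (x + 1) hx x (by omega) le_rfl
      omega
  have stp : ∀ {M m : ℕ} {φ : ℕ → ℕ}, m ≤ M → IsStep M m φ → ∀ k,
      IsStep M m (fun x => max (φ x) (min x (min k m))) := by
    intro M m φ hm h k
    have l := lek hm h
    obtain ⟨h0, h1, h2, h3⟩ := h
    refine ⟨by simp only; omega, by simp only; omega, fun x hx => ?_, fun x hx y hy hxy => ?_⟩
    · have := h2 x hx
      simp only; omega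
    · have := h3 x hx y hy hxy
      simp only; omega
  have adj : ∀ {M m : ℕ} {φ : ℕ → ℕ}, m ≤ M → IsStep M m φ → ∀ k, ∀ x ≤ M, ∀ y ≤ M,
      x ≤ y + 1 → y ≤ x + 1 →
      max (φ x) (min x (min k m)) ≤ max (φ y) (min y (min (k + 1) m)) + 1 ∧
      max (φ x) (min x (min (k + 1) m)) ≤ max (φ y) (min y (min k m)) + 1 := by
    intro M m φ hm h k x hx y hy hxy hyx
    have l := lek hm h
    have := l x hx
    have := l y hy
    obtain ⟨h0, h1, h2, h3⟩ := h
    have := h3 x hx y hy hxy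
    have := h3 y hy x hx hyx
    have := h2 x hx
    have := h2 y hy
    omega
  have chain : ∀ k, FaceContigEquiv X x₀ M N (fun p => f (φ p.1, χ p.2))
      (fun p => f (max (φ p.1) (min p.1 (min k m)), max (χ p.2) (min p.2 (min k n)))) := by
    intro k
    induction k with
    | zero => simp only [Nat.zero_min, Nat.min_zero, Nat.max_zero]; exact Relation.ReflTransGen.refl
    | succ k ih =>
      refine Relation.ReflTransGen.tail ih ⟨faceSphere_pull hf (stp hM hφ k) (stp hN hχ k),
        faceSphere_pull hf (stp hM hφ (k + 1)) (stp hN hχ (k + 1)), ?_⟩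
      intro s hs
      rw [mem_prodInterval] at hs
      have := hf.1
        ((s.image fun p => (max (φ p.1) (min p.1 (min k m)), max (χ p.2) (min p.2 (min k n)))) ∪
        (s.image fun p =>
          (max (φ p.1) (min p.1 (min (k + 1) m)), max (χ p.2) (min p.2 (min (k + 1) n))))) (by
        have A := stp hM hφ k
        have B := stp hN hχ k
        have A' := stp hM hφ (k + 1)
        have B' := stp hN hχ (k + 1)
        rw [mem_prodInterval]
        simp only [Finset.mem_union, Finset.mem_image]
        rintro _ (⟨p, hp, rfl⟩ | ⟨p, hp, rfl⟩)
        · obtain ⟨⟨p1, p2⟩, p3⟩ := hs p hp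
          refine ⟨⟨A.2.2.1 _ p1, B.2.2.1 _ p2⟩, ?_⟩
          rintro _ (⟨q, hq, rfl⟩ | ⟨q, hq, rfl⟩)
          · obtain ⟨⟨q1, q2⟩, q3⟩ := hs q hq
            exact ⟨A.2.2.2 _ p1 _ q1 (p3 q hq).1, B.2.2.2 _ p2 _ q2 (p3 q hq).2⟩
          · obtain ⟨⟨q1, q2⟩, q3⟩ := hs q hq
            exact ⟨(adj hM hφ k _ p1 _ q1 (p3 q hq).1 (q3 p hp).1).1,
              (adj hN hχ k _ p2 _ q2 (p3 q hq).2 (q3 p hp).2).1⟩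
        · obtain ⟨⟨p1, p2⟩, p3⟩ := hs p hp
          refine ⟨⟨A'.2.2.1 _ p1, B'.2.2.1 _ p2⟩, ?_⟩
          rintro _ (⟨q, hq, rfl⟩ | ⟨q, hq, rfl⟩)
          · obtain ⟨⟨q1, q2⟩, q3⟩ := hs q hq
            exact ⟨(adj hM hφ k _ p1 _ q1 (p3 q hq).1 (q3 p hp).1).2,
              (adj hN hχ k _ p2 _ q2 (p3 q hq).2 (q3 p hp).2).2⟩
          · obtain ⟨⟨q1, q2⟩, q3⟩ := hs q hq
            exact ⟨A'.2.2.2 _ p1 _ q1 (p3 q hq).1, B'.2.2.2 _ p2 _ q2 (p3 q hq).2⟩)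
      rw [Finset.image_union, Finset.image_image, Finset.image_image] at this
      exact this
  refine (chain (m + n)).trans (contig_congr
    (faceSphere_pull hf (stp hM hφ (m + n)) (stp hN hχ (m + n))) ?_)
  intro p h1 h2
  rw [trivExt_apply hM hN f h1 h2]
  have a1 := lek hM hφ _ h1
  have a2 := hφ.2.2.1 _ h1
  have b1 := lek hN hχ _ h2
  have b2 := hχ.2.2.1 _ h2
  congr 2 <;> omega

/-- reparametrisation homotopy, from a realization to the realization of its trivial extension -/
theorem htpy_trivExt {X : ASC V} {x₀ : V} {m n M N : ℕ} {f : ℕ × ℕ → V}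
    (hf : IsFaceSphere X x₀ m n f) (hM : m ≤ M) (hN : n ≤ N) :
    HtpyRelBdry X (gridRealize f m n)
      (gridRealize (trivExt m n (M - m) (N - n) f) M N) := by
  have hg := faceSphere_trivExt hf hM hN
  have sg := sphereMap_of_face hg
  have hM' : (m : ℝ) ≤ M := by exact_mod_cast hM
  have hN' : (n : ℝ) ≤ N := by exact_mod_cast hN
  have hm0 : (0 : ℝ) ≤ m := Nat.cast_nonneg m
  have hn0 : (0 : ℝ) ≤ n := Nat.cast_nonneg n
  have box : ∀ a b : ℝ, 0 ≤ a → 0 ≤ b → InBox m n (min a m, min b n) := fun a b ha hb =>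
    ⟨le_min ha hm0, min_le_right _ _, le_min hb hn0, min_le_right _ _⟩
  have box' : ∀ p ∈ unitSquare ×ˢ Icc (0 : ℝ) 1,
      InBox m n (min (((1 - p.2) * m + p.2 * M) * p.1.1) m,
        min (((1 - p.2) * n + p.2 * N) * p.1.2) n) := by
    rintro ⟨⟨y1, y2⟩, t⟩ ⟨⟨⟨h1, h2⟩, h3, h4⟩, h5, h6⟩
    simp only at *
    have : 0 ≤ 1 - t := by linarith
    exact box _ _ (by positivity) (by positivity)
  have step1 : HtpyRelBdry X (gridRealize f m n)
      (fun y => hr f m n (min (M * y.1) m, min (N * y.2) n)) := by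
    refine ⟨fun p => hr f m n (min (((1 - p.2) * m + p.2 * M) * p.1.1) m,
        min (((1 - p.2) * n + p.2 * N) * p.1.2) n), ?_, ?_, ?_, ?_, ?_⟩
    · exact ((hr_continuous f m n).comp (by fun_prop)).continuousOn
    · exact fun p hp => hr_mem hf (box' p hp)
    · intro y hy
      rw [gridRealize_eq f hy]
      have := inBox_of (m := m) (n := n) hy
      simp only [sub_zero, one_mul, zero_mul, add_zero]
      rw [min_eq_left this.2.1, min_eq_left this.2.2.2]
    · intro y hy
      simp
    · intro y hy t ht
      rw [(sphereMap_of_face hf).2.2 y hy]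
      refine hr_bdry hf (box' (y, t) ⟨hy.1, ht⟩) ?_
      have e1 : (m : ℝ) ≤ (1 - t) * m + t * M := by nlinarith [ht.1]
      have e2 : (n : ℝ) ≤ (1 - t) * n + t * N := by nlinarith [ht.1]
      rcases hy.2 with h | h | h | h
      · left; simp [h]
      · right; left; simp [h, e1]
      · right; right; left; simp [h]
      · right; right; right; simp [h, e2]
  refine htpy_trans step1 (htpy_line
    ((hr_continuous f m n).comp (by fun_prop)).continuousOn sg.1 ?_ ?_)
  · intro y hy
    have hb : InBox m n (min (M * y.1) m, min (N * y.2) n) :=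
      box _ _ (inBox_of (m := M) (n := N) hy).1 (inBox_of (m := M) (n := N) hy).2.2.1
    refine ⟨_, cellOf_image hf (min (M * y.1) m, min (N * y.2) n), hr_cell hb, ?_⟩
    rw [gridRealize_eq _ hy]
    refine hr_onS (inBox_of hy) fun p h1 h2 h3 h4 => ?_
    rw [trivExt_apply hM hN f h1 h2]
    refine Finset.mem_image_of_mem f (mem_cellOf.2 ⟨min_le_right _ _, min_le_right _ _, ?_, ?_⟩)
    · simp only [Nat.cast_min]
      exact (abs_min_sub_min_le_max _ _ _ _).trans_lt (by simpa using h3)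
    · simp only [Nat.cast_min]
      exact (abs_min_sub_min_le_max _ _ _ _).trans_lt (by simpa using h4)
  · intro y hy
    rw [sg.2.2 y hy]
    have hb : InBox m n (min (M * y.1) m, min (N * y.2) n) :=
      box _ _ (inBox_of (m := M) (n := N) hy.1).1 (inBox_of (m := M) (n := N) hy.1).2.2.1
    refine hr_bdry hf hb ?_
    rcases hy.2 with h | h | h | h
    · left; simp [h]
    · right; left; simp [h, hM]
    · right; right; left; simp [h]
    · right; right; right; simp [h, hN]

theorem htpy_extContig {X : ASC V} {x₀ : V} {m n m' n' : ℕ} {f g : ℕ × ℕ → V}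
    (hf : IsFaceSphere X x₀ m n f) (hg : IsFaceSphere X x₀ m' n' g)
    (h : ExtContigEquiv X x₀ m n f m' n' g) :
    HtpyRelBdry X (gridRealize f m n) (gridRealize g m' n') := by
  obtain ⟨M, N, h1, h2, h3, h4, h⟩ := h
  exact htpy_trans (htpy_trivExt hf h1 h3) (htpy_trans
    (htpy_faceContig (faceSphere_trivExt hf h1 h3) h) (htpy_symm (htpy_trivExt hg h2 h4)))

/-- the separation inequality -/
theorem sep_ineq {m r M t x : ℝ} (hm : 0 ≤ m) (hr : 0 ≤ r) (hM : m + r ≤ M) (h0 : 0 ≤ t)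
    (h1 : t ≤ 1) (hx0 : 0 ≤ x) (hx1 : x ≤ 1)
    (ha : ((1 - t) * M + t * (2 * m)) * x < m)
    (hb : ((1 - t) * M + t * (2 * r)) * (1 - x) < r) : False := by
  have hM0 : 0 ≤ M := by linarith
  have h1t : 0 ≤ 1 - t := by linarith
  set c := (1 - t) * M + t * (2 * m) with hc
  set c' := (1 - t) * M + t * (2 * r) with hc'
  have cn : 0 ≤ c := by positivity
  have cn' : 0 ≤ c' := by positivity
  have mp : 0 < m := lt_of_le_of_lt (by positivity) ha
  have rp : 0 < r := lt_of_le_of_lt (mul_nonneg cn' (by linarith)) hb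
  have k1 : (1 - t) * r + t * m ≤ c - m := by rw [hc]; nlinarith
  have k2 : (1 - t) * m + t * r ≤ c' - r := by rw [hc']; nlinarith
  have k3 : m * r ≤ ((1 - t) * r + t * m) * ((1 - t) * m + t * r) := by
    have : 0 ≤ t * (1 - t) * (m - r) ^ 2 := by positivity
    nlinarith
  have k4 : ((1 - t) * r + t * m) * ((1 - t) * m + t * r) ≤ (c - m) * (c' - r) :=
    mul_le_mul k1 k2 (by positivity) (le_trans (by positivity) k1)
  have k5 : 0 < c' := by
    have : 0 ≤ (1 - t) * m + t * r := by positivity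
    linarith
  have k6 : c' * (c * x) < c' * m := mul_lt_mul_of_pos_left ha k5
  have k7 : c * (c' * (1 - x)) ≤ c * r := mul_le_mul_of_nonneg_left hb.le cn
  nlinarith

theorem add_sub_vertex_left (a b : V → ℝ) (h : b = a) (w : V → ℝ) : w + b - a = w := by
  rw [h]; simp

theorem add_sub_vertex_right (a b : V → ℝ) (h : b = a) (w : V → ℝ) : b + w - a = w := by
  rw [h]; simp

theorem htpy_fsMul {X : ASC V} {x₀ : V} {m n r s : ℕ} {f g : ℕ × ℕ → V}
    (hf : IsFaceSphere X x₀ m n f) (hg : IsFaceSphere X x₀ r s g)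
    (hfg : IsFaceSphere X x₀ (m + r + 1) (n + s + 1) (fsMul x₀ m n f g)) :
    HtpyRelBdry X (gridRealize (fsMul x₀ m n f g) (m + r + 1) (n + s + 1))
      (hcat (gridRealize f m n) (gridRealize g r s)) := by
  set M : ℝ := ((m + r + 1 : ℕ) : ℝ) with hMdef
  set N : ℝ := ((n + s + 1 : ℕ) : ℝ) with hNdef
  have hM : M = m + r + 1 := by rw [hMdef]; push_cast; ring
  have hN : N = n + s + 1 := by rw [hNdef]; push_cast; ring
  have hm0 : (0 : ℝ) ≤ m := Nat.cast_nonneg m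
  have hn0 : (0 : ℝ) ≤ n := Nat.cast_nonneg n
  have hr0 : (0 : ℝ) ≤ r := Nat.cast_nonneg r
  have hs0 : (0 : ℝ) ≤ s := Nat.cast_nonneg s
  have hM0 : 0 ≤ M := by rw [hM]; positivity
  have hN0 : 0 ≤ N := by rw [hN]; positivity
  -- the two parametrised maps
  let φ : (ℝ × ℝ) × ℝ → ℝ × ℝ := fun p =>
    (min (((1 - p.2) * M + p.2 * (2 * m)) * p.1.1) m,
     min (((1 - p.2) * N + p.2 * n) * p.1.2) n)
  let ψ : (ℝ × ℝ) × ℝ → ℝ × ℝ := fun p =>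
    (r - min (((1 - p.2) * M + p.2 * (2 * r)) * (1 - p.1.1)) r,
     s - min (((1 - p.2) * N + p.2 * s) * (1 - p.1.2)) s)
  have hφc : Continuous φ := by fun_prop
  have hψc : Continuous ψ := by fun_prop
  have boxφ : ∀ p ∈ unitSquare ×ˢ Icc (0 : ℝ) 1, InBox m n (φ p) := by
    rintro ⟨⟨y1, y2⟩, t⟩ ⟨⟨⟨h1, h2⟩, h3, h4⟩, h5, h6⟩
    simp only at h1 h2 h3 h4 h5 h6
    have : 0 ≤ 1 - t := by linarith
    exact ⟨le_min (by positivity) hm0, min_le_right _ _, le_min (by positivity) hn0,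
      min_le_right _ _⟩
  have boxψ : ∀ p ∈ unitSquare ×ˢ Icc (0 : ℝ) 1, InBox r s (ψ p) := by
    rintro ⟨⟨y1, y2⟩, t⟩ ⟨⟨⟨h1, h2⟩, h3, h4⟩, h5, h6⟩
    simp only at h1 h2 h3 h4 h5 h6
    have : 0 ≤ 1 - t := by linarith
    have : 0 ≤ 1 - y1 := by linarith
    have : 0 ≤ 1 - y2 := by linarith
    refine ⟨sub_nonneg.2 (min_le_right _ _), sub_le_self _ (le_min (by positivity) hr0),
      sub_nonneg.2 (min_le_right _ _), sub_le_self _ (le_min (by positivity) hs0)⟩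
  -- one of the two is always trivial
  have triv : ∀ p ∈ unitSquare ×ˢ Icc (0 : ℝ) 1,
      hr f m n (φ p) = vertexPoint x₀ ∨ hr g r s (ψ p) = vertexPoint x₀ := by
    intro p hp
    have b1 := boxφ p hp
    have b2 := boxψ p hp
    obtain ⟨⟨⟨h1, h2⟩, h3, h4⟩, h5, h6⟩ := hp
    by_cases c1 : (m : ℝ) ≤ ((1 - p.2) * M + p.2 * (2 * m)) * p.1.1
    · left; exact hr_bdry hf b1 (Or.inr (Or.inl (min_eq_right c1)))
    by_cases c2 : (r : ℝ) ≤ ((1 - p.2) * M + p.2 * (2 * r)) * (1 - p.1.1)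
    · right; refine hr_bdry hg b2 (Or.inl ?_)
      simp only [ψ, min_eq_right c2, sub_self]
    push Not at c1 c2
    exact (sep_ineq hm0 hr0 (by linarith) h5 h6 h1 h2 c1 c2).elim
  have bdry : ∀ y ∈ squareBdry, ∀ t ∈ Icc (0 : ℝ) 1,
      hr f m n (φ (y, t)) = vertexPoint x₀ ∧ hr g r s (ψ (y, t)) = vertexPoint x₀ := by
    intro y hy t ht
    have b1 := boxφ (y, t) ⟨hy.1, ht⟩
    have b2 := boxψ (y, t) ⟨hy.1, ht⟩
    have t1 : 0 ≤ 1 - t := by linarith [ht.2]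
    have t0 : 0 ≤ t := ht.1
    have e1 : (m : ℝ) ≤ (1 - t) * M + t * (2 * m) := by
      rw [hM]; nlinarith [mul_nonneg t1 hr0, mul_nonneg t0 hm0]
    have e2 : (n : ℝ) ≤ (1 - t) * N + t * n := by
      rw [hN]; nlinarith [mul_nonneg t1 hs0]
    have e3 : (r : ℝ) ≤ (1 - t) * M + t * (2 * r) := by
      rw [hM]; nlinarith [mul_nonneg t1 hm0, mul_nonneg t0 hr0]
    have e4 : (s : ℝ) ≤ (1 - t) * N + t * s := by
      rw [hN]; nlinarith [mul_nonneg t1 hn0]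
    constructor
    · refine hr_bdry hf b1 ?_
      rcases hy.2 with h | h | h | h
      · left; simp [φ, h]
      · right; left; simp [φ, h, e1]
      · right; right; left; simp [φ, h]
      · right; right; right; simp [φ, h, e2]
    · refine hr_bdry hg b2 ?_
      rcases hy.2 with h | h | h | h
      · left; simp [ψ, h, e3]
      · right; left; simp [ψ, h]
      · right; right; left; simp [ψ, h, e4]
      · right; right; right; simp [ψ, h]
  let K : (ℝ × ℝ) × ℝ → V → ℝ := fun p =>
    hr f m n (φ p) + hr g r s (ψ p) - vertexPoint x₀
  have hKc : Continuous K :=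
    (((hr_continuous f m n).comp hφc).add ((hr_continuous g r s).comp hψc)).sub continuous_const
  have hKb : ∀ y ∈ squareBdry, ∀ t ∈ Icc (0 : ℝ) 1, K (y, t) = vertexPoint x₀ := by
    intro y hy t ht
    simp only [K, (bdry y hy t ht).1, (bdry y hy t ht).2]
    simp
  have z01 : (0 : ℝ) ∈ Icc (0 : ℝ) 1 := ⟨le_rfl, zero_le_one⟩
  have step2 : HtpyRelBdry X (fun y => K (y, 0)) (hcat (gridRealize f m n) (gridRealize g r s)) := by
    refine ⟨K, hKc.continuousOn, ?_, fun _ _ => rfl, ?_, ?_⟩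
    · intro p hp
      rcases triv p hp with h | h
      · simp only [K]
        rw [add_sub_vertex_right _ _ h]
        exact hr_mem hg (boxψ p hp)
      · simp only [K]
        rw [add_sub_vertex_left _ _ h]
        exact hr_mem hf (boxφ p hp)
    · intro y hy
      have hp : ((y, 1) : (ℝ × ℝ) × ℝ) ∈ unitSquare ×ˢ Icc (0 : ℝ) 1 :=
        ⟨hy, zero_le_one, le_rfl⟩
      have b1 := boxφ _ hp
      have b2 := boxψ _ hp
      obtain ⟨⟨h1, h2⟩, h3, h4⟩ := hy
      unfold hcat
      simp only [K]
      split_ifs with hc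
      · rw [add_sub_vertex_left, gridRealize_eq (y := (2 * y.1, y.2)) f ⟨⟨by simp only; linarith, by simp only; linarith⟩, h3, h4⟩]
        · congr 1
          simp only [φ, Prod.mk.injEq]
          constructor
          · rw [min_eq_left] <;> nlinarith
          · rw [min_eq_left] <;> nlinarith
        · refine hr_bdry hg b2 (Or.inl ?_)
          simp only [ψ]
          rw [min_eq_right, sub_self]
          nlinarith
      · push Not at hc
        rw [add_sub_vertex_right, gridRealize_eq (y := (2 * y.1 - 1, y.2)) g ⟨⟨by simp only; linarith, by simp only; linarith⟩, h3, h4⟩]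
        · congr 1
          simp only [ψ, Prod.mk.injEq]
          constructor
          · rw [min_eq_left] <;> nlinarith
          · rw [min_eq_left] <;> nlinarith
        · refine hr_bdry hf b1 (Or.inr (Or.inl ?_))
          simp only [φ]
          rw [min_eq_right]
          nlinarith
    · intro y hy t ht
      rw [hKb y hy t ht]; exact (hKb y hy 0 z01).symm
  have sfg := sphereMap_of_face hfg
  refine htpy_trans (htpy_line sfg.1 (hKc.comp (by fun_prop)).continuousOn ?_
    fun y hy => by rw [sfg.2.2 y hy]; exact (hKb y hy 0 z01).symm) step2
  intro y hy
  have hp : ((y, 0) : (ℝ × ℝ) × ℝ) ∈ unitSquare ×ˢ Icc (0 : ℝ) 1 := ⟨hy, z01⟩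
  have b1 := boxφ _ hp
  have b2 := boxψ _ hp
  have b0 := inBox_of (m := m + r + 1) (n := n + s + 1) hy
  rw [gridRealize_eq _ hy]
  rw [← hMdef, ← hNdef] at b0 ⊢
  have hφ0 : φ (y, 0) = (min (M * y.1) m, min (N * y.2) n) := by simp [φ]
  have hψ0 : ψ (y, 0) = (r - min (M * (1 - y.1)) r, s - min (N * (1 - y.2)) s) := by simp [ψ]
  simp only [K, Function.comp_apply]
  rw [hφ0] at b1 ⊢
  rw [hψ0] at b2 ⊢
  generalize hu : M * y.1 = u at *
  generalize hv : N * y.2 = v at *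
  have hu' : M * (1 - y.1) = r - (u - (m + 1)) := by rw [mul_sub, hu, hM]; ring
  have hv' : N * (1 - y.2) = s - (v - (n + 1)) := by rw [mul_sub, hv, hN]; ring
  rw [hu', hv'] at b2 ⊢
  have lt1 : ∀ {a b : ℕ}, (a : ℝ) < b + 1 → a ≤ b := by
    intro a b h
    have : a < b + 1 := by exact_mod_cast h
    omega
  by_cases cA : u ≤ m ∧ v ≤ n
  · have e : hr g r s (r - min (r - (u - (m + 1))) r, s - min (s - (v - (n + 1))) s) =
        vertexPoint x₀ := by
      refine hr_bdry hg b2 (Or.inl ?_)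
      simp only
      rw [min_eq_right (by linarith [cA.1]), sub_self]
    rw [add_sub_vertex_left _ _ e]
    rw [min_eq_left cA.1, min_eq_left cA.2] at b1 ⊢
    refine ⟨_, cellOf_image hf (u, v), hr_onS b0 fun p h1 h2 h3 h4 => ?_, hr_cell b1⟩
    simp only [abs_lt] at h3 h4
    have q1 : p.1 ≤ m := lt1 (by linarith [cA.1])
    have q2 : p.2 ≤ n := lt1 (by linarith [cA.2])
    have : fsMul x₀ m n f g p = f p := by simp [fsMul, q1, q2]
    rw [this]
    exact Finset.mem_image_of_mem f (mem_cellOf.2 ⟨q1, q2, abs_lt.2 h3, abs_lt.2 h4⟩)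
  · have e : hr f m n (min u m, min v n) = vertexPoint x₀ := by
      refine hr_bdry hf b1 ?_
      by_cases cu : u ≤ m
      · right; right; right
        exact min_eq_right (le_of_not_ge fun h => cA ⟨cu, h⟩)
      · right; left
        exact min_eq_right (by linarith)
    rw [add_sub_vertex_right _ _ e]
    by_cases cB : (m : ℝ) + 1 ≤ u ∧ (n : ℝ) + 1 ≤ v
    · rw [min_eq_left (by linarith [cB.1]), min_eq_left (by linarith [cB.2])] at b2 ⊢
      refine ⟨_, cellOf_image hg (r - (r - (u - (m + 1))), s - (s - (v - (n + 1)))),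
        hr_onS b0 fun p h1 h2 h3 h4 => ?_, hr_cell b2⟩
      simp only [abs_lt] at h3 h4
      have q1 : m < p.1 := by
        have : (m : ℝ) < p.1 := by linarith [cB.1]
        exact_mod_cast this
      have q2 : n < p.2 := by
        have : (n : ℝ) < p.2 := by linarith [cB.2]
        exact_mod_cast this
      have : fsMul x₀ m n f g p = g (p.1 - (m + 1), p.2 - (n + 1)) := by
        unfold fsMul
        rw [if_neg (by omega), if_pos (by omega)]
      rw [this]
      refine Finset.mem_image_of_mem g (mem_cellOf.2 ⟨by simp only; omega, by simp only; omega, ?_, ?_⟩)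
      · simp only
        rw [Nat.cast_sub (by omega), abs_lt]
        push_cast
        constructor <;> linarith
      · simp only
        rw [Nat.cast_sub (by omega), abs_lt]
        push_cast
        constructor <;> linarith
    · have e' : hr g r s (r - min (r - (u - (m + 1))) r, s - min (s - (v - (n + 1))) s) =
          vertexPoint x₀ := by
        refine hr_bdry hg b2 ?_
        by_cases cu : (m : ℝ) + 1 ≤ u
        · right; right; left
          simp only
          rw [min_eq_right, sub_self]
          have := le_of_not_ge fun h => cB ⟨cu, h⟩
          linarith
        · left
          simp only
          rw [min_eq_right, sub_self]
          linarith
      rw [e']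
      have hx : ({x₀} : Finset V) ∈ X.faces := by
        have := hf.1 {(0, 0)} (by rw [mem_prodInterval]; simp)
        rw [Finset.image_singleton, hf.2 (0, 0) (by simp) (by simp) (by simp)] at this
        exact this
      refine ⟨_, hx, hr_onS b0 fun p h1 h2 h3 h4 => ?_, OnS_singleton.2 rfl⟩
      simp only [abs_lt] at h3 h4
      rw [Finset.mem_singleton]
      unfold fsMul
      split_ifs with k1 k2
      · refine hf.2 p k1.1 k1.2 ?_
        by_cases cu : u ≤ m
        · have : ¬ v ≤ n := fun h => cA ⟨cu, h⟩
          push Not at this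
          have : n ≤ p.2 := lt1 (by linarith)
          omega
        · push Not at cu
          have : m ≤ p.1 := lt1 (by linarith)
          omega
      · refine hg.2 _ (by simp only; omega) (by simp only; omega) ?_
        simp only
        by_cases cu : (m : ℝ) + 1 ≤ u
        · have : ¬ (n : ℝ) + 1 ≤ v := fun h => cB ⟨cu, h⟩
          push Not at this
          have : p.2 ≤ n + 1 := lt1 (by push_cast; linarith)
          omega
        · push Not at cu
          have : p.1 ≤ m + 1 := lt1 (by push_cast; linarith)
          omega
      · rfl

theorem faceSphere_fsMul {X : ASC V} {x₀ : V} {m n r s : ℕ} {f g : ℕ × ℕ → V}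
    (hf : IsFaceSphere X x₀ m n f) (hg : IsFaceSphere X x₀ r s g) :
    IsFaceSphere X x₀ (m + r + 1) (n + s + 1) (fsMul x₀ m n f g) := by
  constructor
  · intro σ hσ
    rw [mem_prodInterval] at hσ
    by_cases c : ∃ p ∈ σ, p.1 ≤ m ∧ p.2 ≤ n
    · -- pull back to the first block
      obtain ⟨q, hq, q1, q2⟩ := c
      have key : ∀ p ∈ σ, fsMul x₀ m n f g p = f (min p.1 m, min p.2 n) := by
        intro p hp
        obtain ⟨⟨p1, p2⟩, p3⟩ := hσ p hp
        have := p3 q hq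
        unfold fsMul
        split_ifs with k1 k2
        · rw [min_eq_left k1.1, min_eq_left k1.2]
        · rw [hf.2 (min p.1 m, min p.2 n) (min_le_right _ _) (min_le_right _ _)
            (by simp only; omega)]
          exact hg.2 _ (by simp only; omega) (by simp only; omega) (by simp only; omega)
        · exact (hf.2 (min p.1 m, min p.2 n) (min_le_right _ _) (min_le_right _ _)
            (by simp only; omega)).symm
      have := hf.1 (σ.image fun p => (min p.1 m, min p.2 n)) (by
        rw [mem_prodInterval]
        simp only [Finset.mem_image]
        rintro _ ⟨p, hp, rfl⟩
        refine ⟨⟨min_le_right _ _, min_le_right _ _⟩, ?_⟩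
        rintro _ ⟨p', hp', rfl⟩
        have := (hσ p hp).2 p' hp'
        simp only; omega)
      rw [Finset.image_image] at this
      rwa [Finset.image_congr (g := f ∘ fun p => (min p.1 m, min p.2 n))]
      intro p hp
      exact key p hp
    · push Not at c
      have key : ∀ p ∈ σ, fsMul x₀ m n f g p = g (p.1 - (m + 1), p.2 - (n + 1)) := by
        intro p hp
        obtain ⟨⟨p1, p2⟩, p3⟩ := hσ p hp
        have := c p hp
        unfold fsMul
        split_ifs with k1 k2
        · omega
        · rfl
        · exact (hg.2 _ (by simp only; omega) (by simp only; omega) (by simp only; omega)).symm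
      have := hg.1 (σ.image fun p => (p.1 - (m + 1), p.2 - (n + 1))) (by
        rw [mem_prodInterval]
        simp only [Finset.mem_image]
        rintro _ ⟨p, hp, rfl⟩
        have := (hσ p hp).1
        refine ⟨by simp only; omega, ?_⟩
        rintro _ ⟨p', hp', rfl⟩
        have := (hσ p hp).2 p' hp'
        simp only; omega)
      rw [Finset.image_image] at this
      rwa [Finset.image_congr (g := g ∘ fun p => (p.1 - (m + 1), p.2 - (n + 1)))]
      intro p hp
      exact key p hp
  · intro p h1 h2 h
    unfold fsMul
    split_ifs with k1 k2
    · exact hf.2 p k1.1 k1.2 (by omega)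
    · exact hg.2 _ (by simp only; omega) (by simp only; omega) (by simp only; omega)
    · rfl

/-- the cylinder -/
def Cyl : Set ((ℝ × ℝ) × ℝ) := unitSquare ×ˢ Icc (0 : ℝ) 1

theorem lebesgue_vertex {X : ASC V} {H : (ℝ × ℝ) × ℝ → V → ℝ} (hc : ContinuousOn H Cyl)
    (hm : ∀ p ∈ Cyl, H p ∈ realization X) :
    ∃ δ > 0, ∀ q ∈ Cyl, ∃ v, ∀ q' ∈ Cyl, dist q' q < δ → H q' v ≠ 0 := by
  have hcomp : IsCompact Cyl := (isCompact_Icc.prod isCompact_Icc).prod isCompact_Icc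
  have ho : ∀ v : V, ∃ u : Set ((ℝ × ℝ) × ℝ), IsOpen u ∧
      H ⁻¹' {w | 0 < w v} ∩ Cyl = u ∩ Cyl := fun v =>
    continuousOn_iff'.1 hc {w | 0 < w v} (isOpen_lt continuous_const (continuous_apply v))
  choose u hu1 hu2 using ho
  have hcov : Cyl ⊆ ⋃ v, u v := by
    intro q hq
    obtain ⟨h0, s, _, _, hs⟩ := hm q hq
    obtain ⟨v, _, hv⟩ := Finset.exists_ne_zero_of_sum_ne_zero (by rw [hs]; exact one_ne_zero)
    have : q ∈ H ⁻¹' {w | 0 < w v} ∩ Cyl := ⟨lt_of_le_of_ne (h0 v) (Ne.symm hv), hq⟩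
    rw [hu2 v] at this
    exact mem_iUnion.2 ⟨v, this.1⟩
  obtain ⟨δ, hδ, h⟩ := lebesgue_number_lemma_of_metric hcomp hu1 hcov
  refine ⟨δ, hδ, fun q hq => ?_⟩
  obtain ⟨v, hv⟩ := h q hq
  refine ⟨v, fun q' hq' hd => ?_⟩
  have : q' ∈ u v ∩ Cyl := ⟨hv (Metric.mem_ball.2 hd), hq'⟩
  rw [← hu2 v] at this
  exact ne_of_gt this.1

def gpt (L k : ℕ) (p : ℕ × ℕ) : (ℝ × ℝ) × ℝ := (((p.1 : ℝ) / L, (p.2 : ℝ) / L), (k : ℝ) / L)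

theorem grid_div_mem {L a : ℕ} (h : a ≤ L) : ((a : ℝ) / L) ∈ Icc (0 : ℝ) 1 := by
  refine ⟨by positivity, div_le_one_of_le₀ (by exact_mod_cast h) (by positivity)⟩

theorem gpt_mem {L k : ℕ} {p : ℕ × ℕ} (hk : k ≤ L) (h1 : p.1 ≤ L) (h2 : p.2 ≤ L) :
    gpt L k p ∈ Cyl := ⟨⟨grid_div_mem h1, grid_div_mem h2⟩, grid_div_mem hk⟩

theorem div_near {L a b : ℕ} {δ : ℝ} (hL : 0 < L) (hδ : 1 / (L : ℝ) < δ) (h1 : a ≤ b + 1)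
    (h2 : b ≤ a + 1) : |(a : ℝ) / L - (b : ℝ) / L| < δ := by
  have hL' : (0 : ℝ) < L := by exact_mod_cast hL
  have h1' : (a : ℝ) ≤ b + 1 := by exact_mod_cast h1
  have h2' : (b : ℝ) ≤ a + 1 := by exact_mod_cast h2
  rw [← sub_div, abs_div, abs_of_pos hL']
  refine lt_of_le_of_lt ?_ hδ
  gcongr
  rw [abs_le]; constructor <;> linarith

theorem gpt_dist {L k k' : ℕ} {p p' : ℕ × ℕ} {δ : ℝ} (hL : 0 < L) (hδ : 1 / (L : ℝ) < δ)
    (a1 : p.1 ≤ p'.1 + 1) (a2 : p'.1 ≤ p.1 + 1) (b1 : p.2 ≤ p'.2 + 1) (b2 : p'.2 ≤ p.2 + 1)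
    (c1 : k ≤ k' + 1) (c2 : k' ≤ k + 1) : dist (gpt L k p) (gpt L k' p') < δ := by
  rw [Prod.dist_eq, Prod.dist_eq, Real.dist_eq, Real.dist_eq, Real.dist_eq]
  exact max_lt (max_lt (div_near hL hδ a1 a2) (div_near hL hδ b1 b2)) (div_near hL hδ c1 c2)

theorem ap_contig {X : ASC V} {H : (ℝ × ℝ) × ℝ → V → ℝ} (hm : ∀ p ∈ Cyl, H p ∈ realization X)
    {δ : ℝ} {v : (ℝ × ℝ) × ℝ → V}
    (hv : ∀ q ∈ Cyl, ∀ q' ∈ Cyl, dist q' q < δ → H q' (v q) ≠ 0) {L : ℕ} (hL : 0 < L)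
    (hδ : 1 / (L : ℝ) < δ) {k k' : ℕ} (hk : k ≤ L) (hk' : k' ≤ L) (c1 : k ≤ k' + 1)
    (c2 : k' ≤ k + 1) (hx : (∅ : Finset V) ∈ X.faces) :
    Contiguous (prodInterval L L) X (fun p => v (gpt L k p)) (fun p => v (gpt L k' p)) := by
  intro σ hσ
  rw [mem_prodInterval] at hσ
  rcases σ.eq_empty_or_nonempty with rfl | ⟨p, hp⟩
  · simpa using hx
  have hp' := hσ p hp
  obtain ⟨_, s, hs, hs0, _⟩ := hm (gpt L k p) (gpt_mem hk hp'.1.1 hp'.1.2)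
  refine X.down_closed hs (Finset.union_subset ?_ ?_)
  · intro x hx
    obtain ⟨q, hq, rfl⟩ := Finset.mem_image.1 hx
    by_contra hne
    have hq' := hσ q hq
    refine hv (gpt L k q) (gpt_mem hk hq'.1.1 hq'.1.2) (gpt L k p) (gpt_mem hk hp'.1.1 hp'.1.2)
      (gpt_dist hL hδ ?_ ?_ ?_ ?_ (by omega) (by omega)) (hs0 _ hne)
    · exact (hp'.2 q hq).1
    · exact (hq'.2 p hp).1
    · exact (hp'.2 q hq).2
    · exact (hq'.2 p hp).2
  · intro x hx
    obtain ⟨q, hq, rfl⟩ := Finset.mem_image.1 hx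
    by_contra hne
    have hq' := hσ q hq
    refine hv (gpt L k' q) (gpt_mem hk' hq'.1.1 hq'.1.2) (gpt L k p) (gpt_mem hk hp'.1.1 hp'.1.2)
      (gpt_dist hL hδ ?_ ?_ ?_ ?_ (by omega) (by omega)) (hs0 _ hne)
    · exact (hp'.2 q hq).1
    · exact (hq'.2 p hp).1
    · exact (hp'.2 q hq).2
    · exact (hq'.2 p hp).2

theorem empty_face {X : ASC V} {H : (ℝ × ℝ) × ℝ → V → ℝ} (hm : ∀ p ∈ Cyl, H p ∈ realization X) :
    (∅ : Finset V) ∈ X.faces := by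
  obtain ⟨_, s, hs, _⟩ := hm ((0, 0), 0) (by simp [Cyl, unitSquare])
  exact X.down_closed hs (Finset.empty_subset s)

theorem ap_face {X : ASC V} {x₀ : V} {H : (ℝ × ℝ) × ℝ → V → ℝ}
    (hm : ∀ p ∈ Cyl, H p ∈ realization X)
    (hb : ∀ y ∈ squareBdry, ∀ t ∈ Icc (0 : ℝ) 1, H (y, t) = vertexPoint x₀)
    {δ : ℝ} {v : (ℝ × ℝ) × ℝ → V}
    (hv : ∀ q ∈ Cyl, ∀ q' ∈ Cyl, dist q' q < δ → H q' (v q) ≠ 0) {L : ℕ} (hL : 0 < L)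
    (hδ : 1 / (L : ℝ) < δ) {k : ℕ} (hk : k ≤ L) :
    IsFaceSphere X x₀ L L (fun p => v (gpt L k p)) := by
  have hL' : (L : ℝ) ≠ 0 := by exact_mod_cast hL.ne'
  constructor
  · intro σ hσ
    have := ap_contig hm hv hL hδ hk hk (by omega) (by omega) (empty_face hm) σ hσ
    rwa [Finset.union_self] at this
  · intro p h1 h2 h
    have hq := gpt_mem hk h1 h2
    have hne := hv _ hq _ hq (by rw [dist_self]; exact lt_trans (by positivity) hδ)
    by_contra hx
    apply hne
    have : H (gpt L k p) = vertexPoint x₀ := by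
      refine hb _ ⟨hq.1, ?_⟩ _ hq.2
      rcases h with h | h | h | h
      · left; simp [gpt, h]
      · right; left; simp [gpt, h, hL']
      · right; right; left; simp [gpt, h]
      · right; right; right; simp [gpt, h, hL']
    rw [this]
    exact if_neg hx

theorem ap_chain {X : ASC V} {x₀ : V} {H : (ℝ × ℝ) × ℝ → V → ℝ}
    (hm : ∀ p ∈ Cyl, H p ∈ realization X)
    (hb : ∀ y ∈ squareBdry, ∀ t ∈ Icc (0 : ℝ) 1, H (y, t) = vertexPoint x₀)
    {δ : ℝ} {v : (ℝ × ℝ) × ℝ → V}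
    (hv : ∀ q ∈ Cyl, ∀ q' ∈ Cyl, dist q' q < δ → H q' (v q) ≠ 0) {L : ℕ} (hL : 0 < L)
    (hδ : 1 / (L : ℝ) < δ) {k : ℕ} (hk : k ≤ L) :
    FaceContigEquiv X x₀ L L (fun p => v (gpt L 0 p)) (fun p => v (gpt L k p)) := by
  induction k with
  | zero => exact Relation.ReflTransGen.refl
  | succ k ih =>
    exact (ih (by omega)).tail ⟨ap_face hm hb hv hL hδ (by omega), ap_face hm hb hv hL hδ hk,
      ap_contig hm hv hL hδ (by omega) hk (by omega) (by omega) (empty_face hm)⟩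

theorem near_pt {L a : ℕ} {x δ : ℝ} (hL : 0 < L) (hδ : 1 / (L : ℝ) < δ)
    (h : |(L : ℝ) * x - a| < 1) : |x - (a : ℝ) / L| < δ := by
  have hL' : (0 : ℝ) < L := by exact_mod_cast hL
  have e : x - (a : ℝ) / L = (L * x - a) / L := by field_simp
  rw [e, abs_div, abs_of_pos hL']
  refine lt_of_le_of_lt ?_ hδ
  gcongr

theorem phi_surj {X : ASC V} {x₀ : V} {F : ℝ × ℝ → V → ℝ} (hF : IsSphereMap X x₀ F) :
    ∃ (m n : ℕ) (f : ℕ × ℕ → V), IsFaceSphere X x₀ m n f ∧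
      HtpyRelBdry X (gridRealize f m n) F := by
  have hm : ∀ p ∈ Cyl, (fun p : (ℝ × ℝ) × ℝ => F p.1) p ∈ realization X :=
    fun p hp => hF.2.1 _ hp.1
  obtain ⟨δ, hδ, h⟩ := lebesgue_vertex (X := X) (H := fun p => F p.1)
    (hF.1.comp continuousOn_fst fun p hp => hp.1) hm
  classical
  have hex : ∃ v : (ℝ × ℝ) × ℝ → V, ∀ q ∈ Cyl, ∀ q' ∈ Cyl, dist q' q < δ → F q'.1 (v q) ≠ 0 := by
    refine ⟨fun q => if hq : q ∈ Cyl then (h q hq).choose else x₀, fun q hq => ?_⟩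
    simp only [hq, dif_pos]
    exact (h q hq).choose_spec
  obtain ⟨v, hv⟩ := hex
  obtain ⟨L, hL⟩ := exists_nat_one_div_lt hδ
  have hLδ : 1 / ((L + 1 : ℕ) : ℝ) < δ := by push_cast; exact hL
  have hface := ap_face (H := fun p => F p.1) hm (fun y hy t _ => hF.2.2 y hy) hv
    (Nat.succ_pos L) hLδ (Nat.zero_le _)
  refine ⟨L + 1, L + 1, _, hface, ?_⟩
  have sf := sphereMap_of_face hface
  refine htpy_line sf.1 hF.1 (fun y hy => ?_) fun y hy => by rw [sf.2.2 y hy, hF.2.2 y hy]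
  obtain ⟨g0, s, hs, g1, g2⟩ := hF.2.1 y hy
  refine ⟨s, hs, ?_, g0, g1, g2⟩
  rw [gridRealize_eq _ hy]
  refine hr_onS (inBox_of hy) fun p h1 h2 h3 h4 => ?_
  by_contra hne
  refine hv _ (gpt_mem (Nat.zero_le _) h1 h2) (y, 0) ⟨hy, le_rfl, zero_le_one⟩ ?_ (g1 _ hne)
  rw [Prod.dist_eq, Prod.dist_eq, Real.dist_eq, Real.dist_eq, Real.dist_eq]
  refine max_lt (max_lt (near_pt (Nat.succ_pos L) hLδ h3) (near_pt (Nat.succ_pos L) hLδ h4)) ?_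
  simpa [gpt] using hδ

theorem isStep_div {L m : ℕ} (h : m < L) : IsStep L m (fun x => x * m / L) := by
  have hL : 0 < L := by omega
  refine ⟨by simp, ?_, ?_, ?_⟩
  · simp only; rw [Nat.mul_div_cancel_left _ hL]
  · intro x hx
    simp only
    calc x * m / L ≤ L * m / L := Nat.div_le_div_right (Nat.mul_le_mul_right _ hx)
      _ = m := Nat.mul_div_cancel_left _ hL
  · intro x _ y _ hxy
    simp only
    calc x * m / L ≤ (y * m + L) / L := Nat.div_le_div_right (by nlinarith)
      _ = y * m / L + 1 := Nat.add_div_right _ hL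

theorem rep_near {L m i x : ℕ} (h : m < L) (h1 : i ≤ x) (h2 : x ≤ i + 1) :
    |(m : ℝ) * ((i : ℝ) / L) - ((x * m / L : ℕ) : ℝ)| < 1 := by
  have hL : 0 < L := by omega
  have hL' : (0 : ℝ) < L := by exact_mod_cast hL
  have e1 : (x * m / L) * L ≤ x * m := Nat.div_mul_le_self _ _
  have e2 : x * m < (x * m / L) * L + L := by
    have := Nat.lt_div_mul_add (a := x * m) hL
    omega
  generalize x * m / L = c at *
  have f1 : c * L < i * m + L := by nlinarith
  have f2 : i * m < c * L + L := by nlinarith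
  have f1' : (c : ℝ) * L < i * m + L := by exact_mod_cast f1
  have f2' : (i : ℝ) * m < c * L + L := by exact_mod_cast f2
  have e : (m : ℝ) * ((i : ℝ) / L) - c = (i * m - c * L) / L := by field_simp
  rw [e, abs_lt, lt_div_iff₀ hL', div_lt_iff₀ hL']
  constructor <;> linarith

theorem ap_end {X : ASC V} {x₀ : V} {m n L : ℕ} {f A : ℕ × ℕ → V} {δ : ℝ}
    (hf : IsFaceSphere X x₀ m n f) (hA : IsFaceSphere X x₀ L L A) (hm : m < L) (hn : n < L)
    (hδ : 1 / (L : ℝ) < δ)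
    (h : ∀ y ∈ unitSquare, ∀ p : ℕ × ℕ, p.1 ≤ L → p.2 ≤ L → |y.1 - (p.1 : ℝ) / L| < δ →
      |y.2 - (p.2 : ℝ) / L| < δ → gridRealize f m n y (A p) ≠ 0) :
    FaceContigEquiv X x₀ L L A (trivExt m n (L - m) (L - n) f) := by
  have hL : 0 < L := by omega
  refine Relation.ReflTransGen.trans (Relation.ReflTransGen.single
    ⟨hA, faceSphere_pull hf (isStep_div hm) (isStep_div hn), ?_⟩)
    (contig_step hf hm.le hn.le (isStep_div hm) (isStep_div hn))
  intro σ hσ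
  rcases σ.eq_empty_or_nonempty with rfl | hne
  · exact X.down_closed (hf.1 ∅ (by rw [mem_prodInterval]; simp)) (by simp)
  rw [mem_prodInterval] at hσ
  obtain ⟨a, ha, hamin⟩ := Finset.exists_min_image σ Prod.fst hne
  obtain ⟨b, hb, hbmin⟩ := Finset.exists_min_image σ Prod.snd hne
  have hy : (((a.1 : ℝ) / L, (b.2 : ℝ) / L) : ℝ × ℝ) ∈ unitSquare :=
    ⟨grid_div_mem (hσ a ha).1.1, grid_div_mem (hσ b hb).1.2⟩
  refine X.down_closed (cellOf_image hf (m * ((a.1 : ℝ) / L), n * ((b.2 : ℝ) / L)))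
    (Finset.union_subset ?_ ?_)
  · intro x hx
    obtain ⟨p, hp, rfl⟩ := Finset.mem_image.1 hx
    have q1 := (hσ p hp).2 a ha
    have q2 := (hσ p hp).2 b hb
    have q3 := hamin p hp
    have q4 := hbmin p hp
    by_contra hno
    refine h _ hy p (hσ p hp).1.1 (hσ p hp).1.2 ?_ ?_ ((gridRealize_cell hy).2.1 _ hno)
    · exact div_near hL hδ (by omega) (by omega)
    · exact div_near hL hδ (by omega) (by omega)
  · intro x hx
    obtain ⟨p, hp, rfl⟩ := Finset.mem_image.1 hx
    have q1 := (hσ p hp).2 a ha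
    have q2 := (hσ p hp).2 b hb
    have q3 := hamin p hp
    have q4 := hbmin p hp
    refine Finset.mem_image_of_mem f (mem_cellOf.2 ⟨(isStep_div hm).2.2.1 _ (hσ p hp).1.1,
      (isStep_div hn).2.2.1 _ (hσ p hp).1.2, rep_near hm q3 q1.1, rep_near hn q4 q2.2⟩)

theorem phi_inj {X : ASC V} {x₀ : V} {m n m' n' : ℕ} {f g : ℕ × ℕ → V}
    (hf : IsFaceSphere X x₀ m n f) (hg : IsFaceSphere X x₀ m' n' g)
    (h : HtpyRelBdry X (gridRealize f m n) (gridRealize g m' n')) :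
    ExtContigEquiv X x₀ m n f m' n' g := by
  obtain ⟨H, hc, hm, h0, h1, hb⟩ := h
  have hb' : ∀ y ∈ squareBdry, ∀ t ∈ Icc (0 : ℝ) 1, H (y, t) = vertexPoint x₀ :=
    fun y hy t ht => by rw [hb y hy t ht, (sphereMap_of_face hf).2.2 y hy]
  obtain ⟨δ, hδ, hleb⟩ := lebesgue_vertex (X := X) hc hm
  classical
  have hex : ∃ v : (ℝ × ℝ) × ℝ → V, ∀ q ∈ Cyl, ∀ q' ∈ Cyl, dist q' q < δ → H q' (v q) ≠ 0 := by
    refine ⟨fun q => if hq : q ∈ Cyl then (hleb q hq).choose else x₀, fun q hq => ?_⟩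
    simp only [hq, dif_pos]
    exact (hleb q hq).choose_spec
  obtain ⟨v, hv⟩ := hex
  obtain ⟨L₀, hL₀⟩ := exists_nat_one_div_lt hδ
  obtain ⟨L, hL⟩ : ∃ L : ℕ, L = L₀ + 1 + m + n + m' + n' + 1 := ⟨_, rfl⟩
  have hLp : 0 < L := by omega
  have hLδ : 1 / (L : ℝ) < δ := by
    refine lt_of_le_of_lt ?_ hL₀
    have : ((L₀ : ℝ) + 1) ≤ L := by
      have : L₀ + 1 ≤ L := by omega
      exact_mod_cast this
    gcongr
  have hL' : (L : ℝ) ≠ 0 := by exact_mod_cast hLp.ne'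
  have E0 : FaceContigEquiv X x₀ L L (fun p => v (gpt L 0 p))
      (trivExt m n (L - m) (L - n) f) := by
    refine ap_end hf (ap_face hm hb' hv hLp hLδ (Nat.zero_le _)) (by omega) (by omega) hLδ ?_
    intro y hy p p1 p2 d1 d2
    rw [← h0 y hy]
    refine hv _ (gpt_mem (Nat.zero_le _) p1 p2) (y, 0) ⟨hy, le_rfl, zero_le_one⟩ ?_
    rw [Prod.dist_eq, Prod.dist_eq, Real.dist_eq, Real.dist_eq, Real.dist_eq]
    refine max_lt (max_lt d1 d2) ?_
    simpa [gpt] using hδ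
  have E1 : FaceContigEquiv X x₀ L L (fun p => v (gpt L L p))
      (trivExt m' n' (L - m') (L - n') g) := by
    refine ap_end hg (ap_face hm hb' hv hLp hLδ le_rfl) (by omega) (by omega) hLδ ?_
    intro y hy p p1 p2 d1 d2
    rw [← h1 y hy]
    refine hv _ (gpt_mem le_rfl p1 p2) (y, 1) ⟨hy, zero_le_one, le_rfl⟩ ?_
    rw [Prod.dist_eq, Prod.dist_eq, Real.dist_eq, Real.dist_eq, Real.dist_eq]
    refine max_lt (max_lt d1 d2) ?_
    simpa [gpt, hL'] using hδ
  exact ⟨L, L, by omega, by omega, by omega, by omega,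
    (contig_symm E0).trans ((ap_chain hm hb' hv hLp hLδ le_rfl).trans E1)⟩

end HelperStuff

/-- `Φ : F(X, x₀) → π₂(|X|, x₀)`, `Φ([g]) = [|g ∘ E|]`, is a
well-defined group isomorphism.  Since grid vertices are indexed by the same
pairs `(i,j)` as the vertices of `I_m × I_n`, the vertex map of `E` is the
identity and `|g ∘ E| = gridRealize g m n`.  We state: the realization of a
face sphere is a map `(I², ∂I²) → (|X|, x₀)`; Φ is well defined on classes;
Φ is multiplicative; Φ is surjective; and Φ is injective. -/
theorem faceGroup_iso_pi2 {V : Type} [DecidableEq V] (X : ASC V) (x₀ : V) :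
    -- Φ lands in maps (I², ∂I²) → (|X|, x₀)
    (∀ (m n : ℕ) (f : ℕ × ℕ → V), IsFaceSphere X x₀ m n f →
      IsSphereMap X x₀ (gridRealize f m n)) ∧
    -- Φ is well defined on extension-contiguity classes
    (∀ (m n m' n' : ℕ) (f g : ℕ × ℕ → V), IsFaceSphere X x₀ m n f →
      IsFaceSphere X x₀ m' n' g → ExtContigEquiv X x₀ m n f m' n' g →
      HtpyRelBdry X (gridRealize f m n) (gridRealize g m' n')) ∧
    -- Φ is a homomorphism
    (∀ (m n r s : ℕ) (f g : ℕ × ℕ → V), IsFaceSphere X x₀ m n f →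
      IsFaceSphere X x₀ r s g →
      HtpyRelBdry X (gridRealize (fsMul x₀ m n f g) (m + r + 1) (n + s + 1))
        (hcat (gridRealize f m n) (gridRealize g r s))) ∧
    -- Φ is surjective
    (∀ F : ℝ × ℝ → V → ℝ, IsSphereMap X x₀ F →
      ∃ (m n : ℕ) (f : ℕ × ℕ → V), IsFaceSphere X x₀ m n f ∧
        HtpyRelBdry X (gridRealize f m n) F) ∧
    -- Φ is injective
    (∀ (m n m' n' : ℕ) (f g : ℕ × ℕ → V), IsFaceSphere X x₀ m n f →
      IsFaceSphere X x₀ m' n' g →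
      HtpyRelBdry X (gridRealize f m n) (gridRealize g m' n') →
      ExtContigEquiv X x₀ m n f m' n' g) := by
  exact ⟨fun m n f hf => sphereMap_of_face hf,
    fun m n m' n' f g hf hg h => htpy_extContig hf hg h,
    fun m n r s f g hf hg => htpy_fsMul hf hg (faceSphere_fsMul hf hg),
    fun F hF => phi_surj hF,
    fun m n m' n' f g hf hg h => phi_inj hf hg h⟩
end
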